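/- Let (R, 𝔪) be a local Noetherian ring of dimension d and 𝔞 an ideal with H^d_𝔞(R) ≠ 0. Then Ann_R(H^d_𝔞(R)) is the largest ideal I of R (as a submodule of R) with cd(𝔞, I) < d. -/

import Mathlib

open CategoryTheory

universe u

/-- `H^i_I(M) ≠ 0`: the `i`-th local cohomology of `M` with respect to `I` is nonzero. -/
abbrev LCNonzero {R : Type u} [CommRing R] (I : Ideal R) (i : ℕ)
    (M : Type u) [AddCommGroup M] [Module R M] : Prop :=
  Nontrivial ((localCohomology I i).obj (ModuleCat.of R M))

/-- Cohomological dimension `cd(I, M) = sup {i : H^i_I(M) ≠ 0}`, as an element of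
`WithBot ℕ∞` (it is `⊥` if all local cohomology of `M` vanishes). -/
noncomputable def cohDim {R : Type u} [CommRing R] (I : Ideal R)
    (M : Type u) [AddCommGroup M] [Module R M] : WithBot ℕ∞ :=
  sSup {n : WithBot ℕ∞ | ∃ i : ℕ, n = (i : ℕ∞) ∧ LCNonzero I i M}

/-- Krull dimension of a module, i.e. the Krull dimension of `R ⧸ Ann_R M`. -/
noncomputable def modDim (R : Type u) [CommRing R]
    (M : Type u) [AddCommGroup M] [Module R M] : WithBot ℕ∞ :=
  ringKrullDim (R ⧸ Module.annihilator R M)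



/-- Abstract local cohomology theory over a ring. -/
structure LCT (S : Type u) [CommRing S] (b : Ideal S) where
  obj : ℕ → ∀ (M : Type u) [AddCommGroup M] [Module S M], ModuleCat.{u} S
  map : ∀ (i : ℕ) {M N : Type u} [AddCommGroup M] [Module S M] [AddCommGroup N] [Module S N]
    (_ : M →ₗ[S] N), obj i M →ₗ[S] obj i N
  map_comp : ∀ (i : ℕ) {M N P : Type u} [AddCommGroup M] [Module S M] [AddCommGroup N]
    [Module S N] [AddCommGroup P] [Module S P] (f : M →ₗ[S] N) (g : N →ₗ[S] P),
    map i (g ∘ₗ f) = map i g ∘ₗ map i f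
  map_smul : ∀ (i : ℕ) (M : Type u) [AddCommGroup M] [Module S M] (s : S),
    map i (s • (LinearMap.id : M →ₗ[S] M)) = s • LinearMap.id
  exact_mid : ∀ (i : ℕ) {M N P : Type u} [AddCommGroup M] [Module S M] [AddCommGroup N]
    [Module S N] [AddCommGroup P] [Module S P] (f : M →ₗ[S] N) (g : N →ₗ[S] P),
    Function.Injective f → Function.Surjective g → Function.Exact f g →
      Function.Exact (map i f) (map i g)
  exact_del : ∀ (i : ℕ) {M N P : Type u} [AddCommGroup M] [Module S M] [AddCommGroup N]
    [Module S N] [AddCommGroup P] [Module S P] (f : M →ₗ[S] N) (g : N →ₗ[S] P),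
    Function.Injective f → Function.Surjective g → Function.Exact f g →
      ∃ δ : obj i P →ₗ[S] obj (i + 1) M, Function.Exact (map i g) δ ∧
        Function.Exact δ (map (i + 1) f)
  inj_zero : ∀ {M N : Type u} [AddCommGroup M] [Module S M] [AddCommGroup N]
    [Module S N] (f : M →ₗ[S] N), Function.Injective f → Function.Injective (map 0 f)
  tors : ∀ (i : ℕ) (M : Type u) [AddCommGroup M] [Module S M] (x : obj i M),
    ∃ n : ℕ, ∀ r ∈ b ^ n, r • x = 0
  van : ∀ (i : ℕ) (M : Type u) [AddCommGroup M] [Module S M],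
    (∀ r ∈ b, ∀ m : M, r • m = 0) → Subsingleton (obj (i + 1) M)
  emb : ∀ (M : Type u) [AddCommGroup M] [Module S M],
    ∃ f : obj 0 M →ₗ[S] M, Function.Injective f

section supp
variable {S : Type u} [CommRing S]

/-- dévissage for modules with support in a set `Q`. -/
theorem devissage [IsNoetherianRing S] (Q : Set (PrimeSpectrum S))
    (P : (N : Type u) → [AddCommGroup N] → [Module S N] → Prop)
    (hsub : ∀ (N : Type u) [AddCommGroup N] [Module S N] [Subsingleton N], P N)
    (hquot : ∀ p : PrimeSpectrum S, (∀ q : PrimeSpectrum S, p ≤ q → q ∈ Q) →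
      P (S ⧸ p.asIdeal))
    (hex : ∀ (N₁ N₂ N₃ : Type u) [AddCommGroup N₁] [Module S N₁] [AddCommGroup N₂] [Module S N₂]
      [AddCommGroup N₃] [Module S N₃] (f : N₁ →ₗ[S] N₂) (g : N₂ →ₗ[S] N₃),
      Function.Injective f → Function.Surjective g → Function.Exact f g → P N₁ → P N₃ → P N₂)
    (M : Type u) [AddCommGroup M] [Module S M] [hM : Module.Finite S M]
    (h : Module.support S M ⊆ Q) : P M := by
  revert h
  refine IsNoetherianRing.induction_on_isQuotientEquivQuotientPrime S hM
    (motive := fun N _ _ _ => Module.support S N ⊆ Q → P N) ?_ ?_ ?_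
  · intro N _ _ _ _ _
    exact hsub N
  · intro N _ _ _ p e hN
    have h1 : P (S ⧸ p.asIdeal) := by
      apply hquot
      intro q hq
      apply hN
      rw [e.support_eq, Module.support_eq_zeroLocus, Ideal.annihilator_quotient]
      exact hq
    refine hex (S ⧸ p.asIdeal) N PUnit.{u+1} e.symm.toLinearMap 0 e.symm.injective
      (Function.surjective_to_subsingleton _) ?_ h1 (hsub _)
    exact (LinearMap.exact_zero_iff_surjective _ e.symm.toLinearMap).2 e.symm.surjective
  · intro N₁ _ _ _ N₂ _ _ _ N₃ _ _ _ f g hf hg hfg h1 h3 h2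
    refine hex N₁ N₂ N₃ f g hf hg hfg (h1 ?_) (h3 ?_)
    · exact (Module.support_subset_of_injective f hf).trans h2
    · exact (Module.support_subset_of_surjective g hg).trans h2

theorem krull_lt_of_lt {p q : PrimeSpectrum S} (h : p < q) :
    ringKrullDim (S ⧸ q.asIdeal) + 1 ≤ ringKrullDim (S ⧸ p.asIdeal) := by
  have hle : p.asIdeal ≤ q.asIdeal := h.le
  obtain ⟨s, hs, hsp⟩ := SetLike.exists_of_lt (show p.asIdeal < q.asIdeal from h)
  have h1 := ringKrullDim_quotient_succ_le_of_nonZeroDivisor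
    (R := S ⧸ p.asIdeal) (r := Ideal.Quotient.mk _ s)
    (mem_nonZeroDivisors_of_ne_zero (by rwa [Ne, Ideal.Quotient.eq_zero_iff_mem]))
  refine le_trans ?_ h1
  gcongr
  let f : (S ⧸ p.asIdeal) ⧸ Ideal.span {Ideal.Quotient.mk p.asIdeal s} →+* S ⧸ q.asIdeal :=
    Ideal.Quotient.lift _ (Ideal.Quotient.factor hle) (by
      intro a ha
      have : Ideal.span {Ideal.Quotient.mk p.asIdeal s} ≤
          RingHom.ker (Ideal.Quotient.factor hle) := by
        rw [Ideal.span_singleton_le_iff_mem, RingHom.mem_ker, Ideal.Quotient.factor_mk,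
          Ideal.Quotient.eq_zero_iff_mem]
        exact hs
      exact this ha)
  apply ringKrullDim_le_of_surjective f
  apply Ideal.Quotient.lift_surjective_of_surjective
  exact Ideal.Quotient.factor_surjective hle

/-- multiplication by `s` -/
abbrev mulS (M : Type u) [AddCommGroup M] [Module S M] (s : S) : M →ₗ[S] M :=
  s • LinearMap.id

theorem mulS_inj (p : PrimeSpectrum S) {s : S} (hs : s ∉ p.asIdeal) :
    Function.Injective (mulS (S ⧸ p.asIdeal) s) := by
  rw [injective_iff_map_eq_zero]
  intro x hx
  obtain ⟨x, rfl⟩ := Ideal.Quotient.mk_surjective x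
  simp only [LinearMap.smul_apply, LinearMap.id_apply] at hx
  have : Ideal.Quotient.mk p.asIdeal (s * x) = 0 := hx
  rw [Ideal.Quotient.eq_zero_iff_mem] at this ⊢
  exact (p.2.mem_or_mem this).resolve_left hs

theorem supp_modS (p : PrimeSpectrum S) (s : S) {q : PrimeSpectrum S}
    (hq : q ∈ Module.support S ((S ⧸ p.asIdeal) ⧸ LinearMap.range (mulS (S ⧸ p.asIdeal) s))) :
    p ≤ q ∧ s ∈ q.asIdeal := by
  have := Module.annihilator_le_of_mem_support hq
  constructor
  · intro t ht
    apply this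
    rw [Module.mem_annihilator]
    intro m
    obtain ⟨m, rfl⟩ := Submodule.mkQ_surjective _ m
    obtain ⟨m, rfl⟩ := Ideal.Quotient.mk_surjective m
    rw [← map_smul]
    have : t • (Ideal.Quotient.mk p.asIdeal m) = 0 := by
      change Ideal.Quotient.mk p.asIdeal (t * m) = 0
      rw [Ideal.Quotient.eq_zero_iff_mem]
      exact Ideal.mul_mem_right _ _ ht
    rw [this, map_zero]
  · apply this
    rw [Module.mem_annihilator]
    intro m
    obtain ⟨m, rfl⟩ := Submodule.mkQ_surjective _ m
    rw [← map_smul]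
    simp only [Submodule.mkQ_apply, Submodule.Quotient.mk_eq_zero]
    exact ⟨m, rfl⟩

end supp

namespace LCT
variable {S : Type u} [CommRing S] {b : Ideal S} (T : LCT S b)
variable {M N : Type u} [AddCommGroup M] [Module S M] [AddCommGroup N] [Module S N]

theorem map_id (i : ℕ) : T.map i (LinearMap.id : M →ₗ[S] M) = LinearMap.id := by
  have := T.map_smul i M 1
  simpa using this

theorem map_zero (i : ℕ) : T.map i (0 : M →ₗ[S] N) = 0 := by
  have h : (0 : M →ₗ[S] N) = 0 ∘ₗ ((0 : S) • LinearMap.id) := by simp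
  rw [h, T.map_comp, T.map_smul]
  simp

theorem smul_apply (i : ℕ) (s : S) (x : T.obj i M) : T.map i (mulS M s) x = s • x := by
  rw [mulS, T.map_smul]; rfl

theorem subsingleton_of_subsingleton (i : ℕ) [Subsingleton M] : Subsingleton (T.obj i M) := by
  have h : (LinearMap.id : M →ₗ[S] M) = 0 := Subsingleton.elim _ _
  have h1 := T.map_id (M := M) i
  rw [h, T.map_zero] at h1
  refine ⟨fun x y => ?_⟩
  have hx := LinearMap.congr_fun h1 x
  have hy := LinearMap.congr_fun h1 y
  simp at hx hy
  rw [← hx, ← hy]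

/-- functoriality for isos -/
noncomputable def mapEquiv (i : ℕ) (e : M ≃ₗ[S] N) : T.obj i M ≃ₗ[S] T.obj i N :=
  LinearEquiv.ofLinearMap (T.map i e.toLinearMap) (T.map i e.symm.toLinearMap)
    (by rw [← T.map_comp]; simp [T.map_id]) (by rw [← T.map_comp]; simp [T.map_id])

theorem mid_subsingleton (i : ℕ) {P : Type u} [AddCommGroup P] [Module S P]
    (f : M →ₗ[S] N) (g : N →ₗ[S] P) (hf : Function.Injective f) (hg : Function.Surjective g)
    (h : Function.Exact f g) (h1 : Subsingleton (T.obj i M)) (h2 : Subsingleton (T.obj i P)) :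
    Subsingleton (T.obj i N) := by
  refine subsingleton_of_forall_eq 0 fun x => ?_
  obtain ⟨y, rfl⟩ := (T.exact_mid i f g hf hg h x).1 (Subsingleton.elim _ _)
  rw [Subsingleton.elim y 0, _root_.map_zero]

theorem del_quot (i : ℕ) (f : M →ₗ[S] N) (hf : Function.Injective f) :
    ∃ δ : T.obj i (N ⧸ LinearMap.range f) →ₗ[S] T.obj (i + 1) M,
      Function.Exact (T.map i (LinearMap.range f).mkQ) δ ∧
        Function.Exact δ (T.map (i + 1) f) :=
  T.exact_del i f _ hf (Submodule.mkQ_surjective _) (LinearMap.exact_map_mkQ_range f)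

theorem subsingleton_of_inj (i : ℕ) {s : S} (hs : s ∈ b)
    (h : ∀ x : T.obj i M, s • x = 0 → x = 0) : Subsingleton (T.obj i M) := by
  refine subsingleton_of_forall_eq 0 fun x => ?_
  obtain ⟨n, hn⟩ := T.tors i M x
  have := hn _ (Ideal.pow_mem_pow hs n)
  clear hn
  induction n with
  | zero => simpa using this
  | succ n ih =>
    apply ih
    apply h
    rwa [smul_smul, ← pow_succ']

theorem vanish [IsNoetherianRing S] (i : ℕ) : ∀ (M : Type u) [AddCommGroup M] [Module S M]
    [Module.Finite S M],
    (Module.support S M ⊆ {p | ringKrullDim (S ⧸ p.asIdeal) < (i : WithBot ℕ∞)}) →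
      Subsingleton (T.obj i M) := by
  induction i with
  | zero =>
    intro M _ _ _ h
    have : Subsingleton M := by
      rw [← Module.support_eq_empty_iff (R := S), Set.eq_empty_iff_forall_notMem]
      intro p hp
      have h1 := h hp
      simp only [Set.mem_ofPred_eq] at h1
      exact absurd h1 (not_lt.2 (by simpa using ringKrullDim_nonneg_of_nontrivial))
    exact T.subsingleton_of_subsingleton 0
  | succ i ih =>
    intro M _ _ _ h
    refine devissage _ (fun N _ _ => Subsingleton (T.obj (i + 1) N)) ?_ ?_ ?_ M h
    · intro N _ _ _
      exact T.subsingleton_of_subsingleton _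
    · intro p hp
      by_cases hbp : b ≤ p.asIdeal
      · apply T.van
        intro r hr m
        obtain ⟨m, rfl⟩ := Ideal.Quotient.mk_surjective m
        change Ideal.Quotient.mk p.asIdeal (r * m) = 0
        rw [Ideal.Quotient.eq_zero_iff_mem]
        exact Ideal.mul_mem_right _ _ (hbp hr)
      · obtain ⟨s, hs, hsp⟩ := SetLike.not_le_iff_exists.1 hbp
        apply T.subsingleton_of_inj _ hs
        intro x hx
        rw [← T.smul_apply] at hx
        obtain ⟨δ, -, h2⟩ := T.del_quot i (mulS (S ⧸ p.asIdeal) s) (mulS_inj p hsp)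
        obtain ⟨y, rfl⟩ := (h2 x).1 hx
        have := ih ((S ⧸ p.asIdeal) ⧸ LinearMap.range (mulS (S ⧸ p.asIdeal) s)) (by
          intro q hq
          obtain ⟨h3, h4⟩ := supp_modS p s hq
          have h5 : p < q := lt_of_le_of_ne h3 (by rintro rfl; exact hsp h4)
          have h6 := krull_lt_of_lt h5
          have h7 := hp p le_rfl
          simp only [Set.mem_ofPred_eq] at h7 ⊢
          have h8 := lt_of_le_of_lt h6 h7
          push_cast at h8
          exact lt_of_add_lt_add_right h8)
        rw [Subsingleton.elim y 0, _root_.map_zero]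
    · intro N₁ N₂ N₃ _ _ _ _ _ _ f g hf hg hfg h1 h3
      exact T.mid_subsingleton _ f g hf hg hfg h1 h3

end LCT


set_option linter.unusedSectionVars false

section good
variable {S : Type u} [CommRing S] [IsNoetherianRing S] (n : Ideal S)
variable (E : Type u) [AddCommGroup E] [Module S E]

/-- `n`-torsion elements -/
def TorsEl {B : Type u} [AddCommGroup B] [Module S B] (x : B) : Prop :=
  ∃ k : ℕ, ∀ r ∈ n ^ k, r • x = 0

variable {n} in
theorem TorsEl.of_smul {B : Type u} [AddCommGroup B] [Module S B] (x : B) (k : ℕ)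
    (h : ∀ r ∈ n ^ k, TorsEl n (r • x)) : TorsEl n x := by
  obtain ⟨s, hs⟩ : (n ^ k).FG := IsNoetherian.noetherian _
  have h' : ∀ r : S, ∃ j : ℕ, r ∈ n ^ k → ∀ t ∈ n ^ j, t • (r • x) = 0 := by
    intro r
    by_cases hr : r ∈ n ^ k
    · obtain ⟨j, hj⟩ := h r hr
      exact ⟨j, fun _ => hj⟩
    · exact ⟨0, fun h => absurd h hr⟩
  choose j hj using h'
  let J := s.sup j
  refine ⟨J + k, fun t ht => ?_⟩
  rw [pow_add] at ht
  refine Submodule.mul_induction_on ht ?_ ?_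
  · intro u hu v hv
    rw [mul_smul]
    rw [← hs] at hv
    refine Submodule.span_induction ?_ ?_ ?_ ?_ hv
    · intro r hr
      have hr' : r ∈ n ^ k := by rw [← hs]; exact Submodule.subset_span hr
      exact hj r hr' u (Ideal.pow_le_pow_right (Finset.le_sup hr) hu)
    · simp
    · intro a c _ _ ha hc
      rw [add_smul, smul_add, ha, hc, add_zero]
    · intro a c _ hc
      rw [smul_assoc, smul_comm, hc, smul_zero]
  · intro a c ha hc
    rw [add_smul, ha, hc, add_zero]

/-- the class of torsion modules whose dual is finite with support in `Z` -/
def Good (Z : Set (PrimeSpectrum S)) (B : Type u) [AddCommGroup B] [Module S B] : Prop :=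
  (∀ x : B, TorsEl n x) ∧ Module.Finite S (B →ₗ[S] E) ∧ Module.support S (B →ₗ[S] E) ⊆ Z

variable {n E} {Z : Set (PrimeSpectrum S)}
variable {B C D : Type u} [AddCommGroup B] [Module S B] [AddCommGroup C] [Module S C]
  [AddCommGroup D] [Module S D]

theorem lcomp_inj (f : B →ₗ[S] C) (hf : Function.Surjective f) :
    Function.Injective (LinearMap.lcomp S E f) := by
  intro g h hgh
  ext x
  obtain ⟨y, rfl⟩ := hf x
  exact LinearMap.congr_fun hgh y

theorem lcomp_surj [Module.Injective S E] (f : B →ₗ[S] C) (hf : Function.Injective f) :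
    Function.Surjective (LinearMap.lcomp S E f) := by
  intro g
  obtain ⟨h, hh⟩ := Module.Injective.extension_property S E B C f hf g
  exact ⟨h, hh⟩

theorem lcomp_exact [Module.Injective S E] (f : B →ₗ[S] C) (g : C →ₗ[S] D)
    (h : Function.Exact f g) :
    Function.Exact (LinearMap.lcomp S E g) (LinearMap.lcomp S E f) := by
  intro φ
  constructor
  · intro hφ
    have hk : LinearMap.ker g ≤ LinearMap.ker φ := by
      intro x hx
      obtain ⟨y, rfl⟩ := (h x).1 hx
      exact LinearMap.congr_fun hφ y
    let φ' : (C ⧸ LinearMap.ker g) →ₗ[S] E := (LinearMap.ker g).liftQ φ hk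
    let g' : (C ⧸ LinearMap.ker g) →ₗ[S] D := (LinearMap.ker g).liftQ g le_rfl
    have hg' : Function.Injective g' := by
      rw [← LinearMap.ker_eq_bot]
      exact Submodule.ker_liftQ_eq_bot _ _ _ le_rfl
    obtain ⟨ψ, hψ⟩ := Module.Injective.extension_property S E _ D g' hg' φ'
    refine ⟨ψ, ?_⟩
    ext x
    exact LinearMap.congr_fun hψ (Submodule.Quotient.mk x)
  · rintro ⟨ψ, rfl⟩
    ext x
    simp [LinearMap.lcomp_apply, h.apply_apply_eq_zero]

theorem Good.of_surj (f : B →ₗ[S] C) (hf : Function.Surjective f) (h : Good n E Z B) :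
    Good n E Z C := by
  obtain ⟨h1, h2, h3⟩ := h
  refine ⟨?_, Module.Finite.of_injective _ (lcomp_inj f hf), ?_⟩
  · intro x
    obtain ⟨y, rfl⟩ := hf x
    obtain ⟨k, hk⟩ := h1 y
    exact ⟨k, fun r hr => by rw [← map_smul, hk r hr, map_zero]⟩
  · exact (Module.support_subset_of_injective _ (lcomp_inj f hf)).trans h3

theorem Good.of_inj [Module.Injective S E] (f : B →ₗ[S] C) (hf : Function.Injective f)
    (h : Good n E Z C) : Good n E Z B := by
  obtain ⟨h1, h2, h3⟩ := h
  refine ⟨?_, Module.Finite.of_surjective _ (lcomp_surj f hf), ?_⟩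
  · intro x
    obtain ⟨k, hk⟩ := h1 (f x)
    exact ⟨k, fun r hr => hf (by rw [map_smul, hk r hr, map_zero])⟩
  · exact (Module.support_subset_of_surjective _ (lcomp_surj f hf)).trans h3

theorem Good.of_exact [Module.Injective S E] (f : B →ₗ[S] C) (g : C →ₗ[S] D)
    (h : Function.Exact f g) (hB : Good n E Z B) (hD : Good n E Z D) : Good n E Z C := by
  obtain ⟨h1, h2, h3⟩ := hB
  obtain ⟨h1', h2', h3'⟩ := hD
  have hex := lcomp_exact (E := E) f g h
  refine ⟨?_, ?_, ?_⟩
  · intro x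
    obtain ⟨k, hk⟩ := h1' (g x)
    refine TorsEl.of_smul x k fun r hr => ?_
    obtain ⟨y, hy⟩ := (h (r • x)).1 (by rw [map_smul, hk r hr])
    rw [← hy]
    obtain ⟨j, hj⟩ := h1 y
    exact ⟨j, fun r hr => by rw [← map_smul, hj r hr, map_zero]⟩
  · have := isNoetherian_of_range_eq_ker _ _ (LinearMap.exact_iff.1 hex).symm
    infer_instance
  · intro q hq
    by_contra hZ
    have hB : q ∉ Module.support S (B →ₗ[S] E) := fun h => hZ (h3 h)
    have hD : q ∉ Module.support S (D →ₗ[S] E) := fun h => hZ (h3' h)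
    rw [Module.notMem_support_iff'] at hB hD
    refine absurd hq ?_
    rw [Module.notMem_support_iff']
    intro φ
    obtain ⟨r, hr, hr0⟩ := hB (LinearMap.lcomp S E f φ)
    rw [← map_smul] at hr0
    obtain ⟨ψ, hψ⟩ := (hex _).1 hr0
    obtain ⟨t, ht, ht0⟩ := hD ψ
    refine ⟨t * r, q.asIdeal.primeCompl.mul_mem ht hr, ?_⟩
    rw [mul_smul, ← hψ, ← map_smul, ht0, map_zero]

theorem Good.of_subsingleton [Subsingleton B] : Good n E Z B := by
  have : Subsingleton (B →ₗ[S] E) := ⟨fun f g => by ext x; rw [Subsingleton.elim x 0]; simp⟩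
  refine ⟨fun x => ⟨0, fun r _ => Subsingleton.elim _ _⟩, inferInstance, ?_⟩
  rw [Module.support_eq_empty]
  exact Set.empty_subset _

theorem Good.mono {Z' : Set (PrimeSpectrum S)} (hZ : Z ⊆ Z') (h : Good n E Z B) :
    Good n E Z' B := ⟨h.1, h.2.1, h.2.2.trans hZ⟩

instance precomplete_pi [IsPrecomplete n S] (r : ℕ) : IsPrecomplete n (Fin r → S) := by
  constructor
  intro f hf
  have key : ∀ (k : ℕ) (v : Fin r → S), v ∈ (n ^ k • ⊤ : Submodule S (Fin r → S)) ↔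
      ∀ i, v i ∈ n ^ k := by
    intro k v
    constructor
    · intro hv i
      refine Submodule.smul_induction_on hv ?_ ?_
      · intro a ha w _
        exact Ideal.mul_mem_right _ _ ha
      · intro x y hx hy
        exact Ideal.add_mem _ hx hy
    · intro hv
      have : v = ∑ i, v i • (Pi.single i (1 : S) : Fin r → S) := by
        ext j
        simp [Finset.sum_apply, Pi.single_apply]
      rw [this]
      exact Submodule.sum_mem _ fun i _ => Submodule.smul_mem_smul (hv i) trivial
  have hc : ∀ i : Fin r, ∃ L : S, ∀ k, f k i ≡ L [SMOD (n ^ k • ⊤ : Submodule S S)] := by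
    intro i
    apply IsPrecomplete.prec'
    intro a c hac
    have := hf hac
    rw [SModEq.sub_mem, key] at this
    rw [SModEq.sub_mem]
    simpa using this i
  choose L hL using hc
  refine ⟨L, fun k => ?_⟩
  rw [SModEq.sub_mem, key]
  intro i
  have := hL i k
  rw [SModEq.sub_mem] at this
  simpa using this

theorem finite_of_complete [IsPrecomplete n S] (K : Type u) [AddCommGroup K] [Module S K]
    [IsHausdorff n K] (h : Module.Finite S (K ⧸ (n • ⊤ : Submodule S K))) :
    Module.Finite S K := by
  obtain ⟨r, g, hg⟩ := Module.Finite.exists_fin' S (K ⧸ (n • ⊤ : Submodule S K))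
  obtain ⟨f, hf⟩ := Module.projective_lifting_property (n • ⊤ : Submodule S K).mkQ g
    (Submodule.mkQ_surjective _)
  have : Function.Surjective f :=
    surjective_of_mkQ_comp_surjective (I := n) (by rw [hf]; exact hg)
  exact Module.Finite.of_surjective f this

theorem Good.step [Module.Injective S E] [IsPrecomplete n S] {s : S} (hs : s ∈ n)
    (hB : ∀ x : B, ∃ k : ℕ, s ^ k • x = 0)
    (h : Good n E Z (LinearMap.ker (mulS B s))) :
    Good n E {q | ∀ q' : PrimeSpectrum S, q ≤ q' → s ∈ q'.asIdeal → q' ∈ Z} B := by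
  obtain ⟨h1, h2, h3⟩ := h
  have ht : ∀ x : B, TorsEl n x := by
    intro x
    obtain ⟨k, hk⟩ := hB x
    induction k generalizing x with
    | zero => exact ⟨0, fun r _ => by simp at hk; simp [hk]⟩
    | succ k ih =>
      rw [pow_succ, mul_smul] at hk
      obtain ⟨j, hj⟩ := ih (s • x) hk
      refine TorsEl.of_smul x j fun r hr => ?_
      obtain ⟨l, hl⟩ := h1 ⟨r • x, by
        rw [LinearMap.mem_ker]; simp only [LinearMap.smul_apply, LinearMap.id_apply]
        rw [smul_comm]; exact hj r hr⟩
      exact ⟨l, fun t ht => congrArg Subtype.val (hl t ht)⟩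
  have hH : IsHausdorff n (B →ₗ[S] E) := by
    constructor
    intro f hf
    ext x
    obtain ⟨k, hk⟩ := ht x
    have := hf k
    rw [SModEq.zero] at this
    simp only [LinearMap.zero_apply]
    refine Submodule.smul_induction_on this ?_ ?_
    · intro r hr g _
      rw [LinearMap.smul_apply, ← map_smul, hk r hr, map_zero]
    · intro g g' hg hg'
      rw [LinearMap.add_apply, hg, hg', add_zero]
  have hex : Function.Exact (LinearMap.lcomp S E (mulS B s))
      (LinearMap.lcomp S E (LinearMap.ker (mulS B s)).subtype) :=
    lcomp_exact _ _ (LinearMap.exact_subtype_ker_map _)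
  have hsur := lcomp_surj (E := E) (LinearMap.ker (mulS B s)).subtype
    (Submodule.subtype_injective _)
  have hrange : ∀ φ : B →ₗ[S] E, LinearMap.lcomp S E (mulS B s) φ = s • φ := by
    intro φ
    ext x
    simp
  -- the kernel of restriction is `s • ⊤`
  have hfin : Module.Finite S ((B →ₗ[S] E) ⧸ (n • ⊤ : Submodule S (B →ₗ[S] E))) := by
    let ρ := LinearMap.lcomp S E (LinearMap.ker (mulS B s)).subtype
    have hker : LinearMap.ker ρ ≤ n • ⊤ := by
      intro φ hφ
      obtain ⟨ψ, rfl⟩ := (hex φ).1 hφ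
      rw [hrange]
      exact Submodule.smul_mem_smul hs trivial
    let e := ρ.quotKerEquivOfSurjective hsur
    have : Module.Finite S ((B →ₗ[S] E) ⧸ LinearMap.ker ρ) := Module.Finite.equiv e.symm
    exact Module.Finite.of_surjective (Submodule.factor hker)
      (Submodule.factor_surjective hker)
  have hK := finite_of_complete (B →ₗ[S] E) hfin
  refine ⟨ht, hK, ?_⟩
  intro q hq q' hqq' hsq'
  apply h3
  have hq' := Module.mem_support_mono hqq' hq
  have h5 : q' ∈ Module.support S ((B →ₗ[S] E) ⧸
      (Ideal.span {s} • ⊤ : Submodule S (B →ₗ[S] E))) := by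
    rw [Module.support_quotient]
    refine ⟨hq', ?_⟩
    rw [PrimeSpectrum.zeroLocus_span]
    simpa [PrimeSpectrum.mem_zeroLocus] using hsq'
  have h6 : (Ideal.span {s} • ⊤ : Submodule S (B →ₗ[S] E)) ≤
      LinearMap.ker (LinearMap.lcomp S E (LinearMap.ker (mulS B s)).subtype) := by
    rw [Submodule.smul_le]
    intro r hr φ _
    obtain ⟨c, rfl⟩ := Ideal.mem_span_singleton'.1 hr
    rw [LinearMap.mem_ker, hex]
    exact ⟨c • φ, by rw [hrange, smul_smul, mul_comm]⟩
  have h7 : LinearMap.ker (LinearMap.lcomp S E (LinearMap.ker (mulS B s)).subtype) ≤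
      (Ideal.span {s} • ⊤ : Submodule S (B →ₗ[S] E)) := by
    intro φ hφ
    obtain ⟨ψ, rfl⟩ := (hex φ).1 hφ
    rw [hrange]
    exact Submodule.smul_mem_smul (Ideal.mem_span_singleton_self s) trivial
  rw [le_antisymm h6 h7] at h5
  rwa [((LinearMap.lcomp S E (LinearMap.ker (mulS B s)).subtype).quotKerEquivOfSurjective
    hsur).support_eq] at h5

end good


set_option linter.unusedSectionVars false

theorem wb_le_of_add (a : WithBot ℕ∞) (k : ℕ) (h : a + 1 ≤ (k : WithBot ℕ∞) + 1) :
    a ≤ (k : WithBot ℕ∞) := by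
  induction a with
  | bot => exact bot_le
  | coe a =>
    have h' : a + 1 ≤ (k : ℕ∞) + 1 := by exact_mod_cast h
    have : a ≤ k := (ENat.add_le_add_iff_right (by simp)).1 h'
    exact_mod_cast this

theorem wb_one_le_zero (h : (1 : WithBot ℕ∞) ≤ 0) : False := by
  have : (1 : ℕ) ≤ 0 := by exact_mod_cast h
  omega

section dims
variable {S : Type u} [CommRing S] [IsNoetherianRing S]

theorem dim_quot_le (I : Ideal S) (k : ℕ)
    (h : ∀ q : PrimeSpectrum S, I ≤ q.asIdeal →
      ringKrullDim (S ⧸ q.asIdeal) ≤ (k : WithBot ℕ∞)) :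
    ringKrullDim (S ⧸ I) ≤ (k : WithBot ℕ∞) := by
  rw [ringKrullDim_quotient, Order.krullDim]
  apply iSup_le
  intro l
  have h1 := h l.head.1 l.head.2
  refine le_trans ?_ h1
  rw [ringKrullDim_quotient]
  let l' : LTSeries (PrimeSpectrum.zeroLocus (l.head.1.asIdeal : Set S)) :=
    { length := l.length
      toFun := fun i => ⟨(l i).1, by
        have : l.head ≤ l i := LTSeries.head_le l i
        exact this⟩
      step := fun i => l.step i }
  exact le_iSup (fun p : LTSeries (PrimeSpectrum.zeroLocus (l.head.1.asIdeal : Set S)) =>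
    ((p.length : ℕ∞) : WithBot ℕ∞)) l'

theorem dim_le_succ [IsLocalRing S] (q : PrimeSpectrum S) (s : S)
    (hs : s ∈ IsLocalRing.maximalIdeal S) (k : ℕ)
    (h : ∀ q' : PrimeSpectrum S, q ≤ q' → s ∈ q'.asIdeal →
      ringKrullDim (S ⧸ q'.asIdeal) ≤ (k : WithBot ℕ∞)) :
    ringKrullDim (S ⧸ q.asIdeal) ≤ ((k + 1 : ℕ) : WithBot ℕ∞) := by
  have : IsLocalRing (S ⧸ q.asIdeal) :=
    IsLocalRing.of_surjective' (Ideal.Quotient.mk q.asIdeal) Ideal.Quotient.mk_surjective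
  have h1 := ringKrullDim_le_ringKrullDim_quotient_add_card (R := S ⧸ q.asIdeal)
    {Ideal.Quotient.mk q.asIdeal s} (by
      rw [Finset.coe_singleton, Set.singleton_subset_iff, IsLocalRing.ringJacobson_eq_maximalIdeal]
      intro hu
      obtain ⟨y, hy⟩ := isUnit_iff_exists_inv.1 hu
      obtain ⟨y, rfl⟩ := Ideal.Quotient.mk_surjective y
      rw [← map_mul, ← map_one (Ideal.Quotient.mk q.asIdeal), Ideal.Quotient.eq] at hy
      have h2 := IsLocalRing.le_maximalIdeal q.2.ne_top hy
      have h3 : (1 : S) ∈ IsLocalRing.maximalIdeal S := by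
        have := Ideal.sub_mem _ (Ideal.mul_mem_right y _ hs) h2
        simpa using this
      exact (IsLocalRing.maximalIdeal.isMaximal S).ne_top ((Ideal.eq_top_iff_one _).2 h3))
  rw [Finset.card_singleton] at h1
  refine h1.trans ?_
  push_cast
  gcongr
  rw [Finset.coe_singleton]
  have e : ringKrullDim ((S ⧸ q.asIdeal) ⧸ Ideal.span {Ideal.Quotient.mk q.asIdeal s}) =
      ringKrullDim (S ⧸ (q.asIdeal ⊔ Ideal.span {s})) := by
    rw [← Set.image_singleton, ← Ideal.map_span]
    exact ringKrullDim_eq_of_ringEquiv (DoubleQuot.quotQuotEquivQuotSup _ _)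
  rw [e]
  apply dim_quot_le
  intro q' hq'
  refine h q' (le_sup_left.trans hq') (hq' (Ideal.mem_sup_right (Ideal.mem_span_singleton_self s)))

end dims

namespace LCT
variable {S : Type u} [CommRing S] [IsNoetherianRing S] {b : Ideal S} (T : LCT S b)
variable {M N : Type u} [AddCommGroup M] [Module S M] [AddCommGroup N] [Module S N]

theorem map_surj (d : ℕ) (hd : ringKrullDim S ≤ (d : WithBot ℕ∞)) [Module.Finite S M]
    (f : M →ₗ[S] N) (hf : Function.Surjective f) : Function.Surjective (T.map d f) := by
  obtain ⟨δ, h1, -⟩ := T.exact_del d (LinearMap.ker f).subtype f (Submodule.subtype_injective _)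
    hf (LinearMap.exact_subtype_ker_map _)
  have : Subsingleton (T.obj (d + 1) (LinearMap.ker f)) := by
    apply T.vanish
    intro q _
    have h2 : ringKrullDim (S ⧸ q.asIdeal) ≤ (d : WithBot ℕ∞) :=
      (ringKrullDim_quotient_le _).trans hd
    refine lt_of_le_of_lt h2 ?_
    exact_mod_cast Nat.lt_succ_self d
  intro x
  exact (h1 x).1 (Subsingleton.elim _ _)

theorem lt_of_mem {d : ℕ} (hd : ringKrullDim S ≤ (d : WithBot ℕ∞)) {p q : PrimeSpectrum S}
    (h : p < q) : ringKrullDim (S ⧸ q.asIdeal) < (d : WithBot ℕ∞) := by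
  have h1 := (krull_lt_of_lt h).trans ((ringKrullDim_quotient_le _).trans hd)
  cases d with
  | zero =>
    have h0 : (0 : WithBot ℕ∞) ≤ ringKrullDim (S ⧸ q.asIdeal) :=
      ringKrullDim_nonneg_of_nontrivial
    have h2 : (0 : WithBot ℕ∞) + 1 ≤ ringKrullDim (S ⧸ q.asIdeal) + 1 := by gcongr
    have h3 := h2.trans h1
    simp at h3
    exact (wb_one_le_zero h3).elim
  | succ d =>
    push_cast at h1
    have h4 : ringKrullDim (S ⧸ q.asIdeal) ≤ (d : WithBot ℕ∞) := by
      exact wb_le_of_add _ _ h1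
    refine lt_of_le_of_lt h4 ?_
    exact_mod_cast Nat.lt_succ_self d

theorem smul_surj (d : ℕ) (hd : ringKrullDim S ≤ (d : WithBot ℕ∞)) [Module.Finite S M]
    (p : PrimeSpectrum S) (hM : ∀ q ∈ Module.support S M, p ≤ q) (t : S) (ht : t ∉ p.asIdeal)
    (x : T.obj d M) : ∃ y : T.obj d M, t • y = x := by
  let R' := LinearMap.range (mulS M t)
  have hQ : Subsingleton (T.obj d (M ⧸ R')) := by
    apply T.vanish
    intro q hq
    have h1 : p ≤ q := hM q (Module.support_subset_of_surjective _ (Submodule.mkQ_surjective R') hq)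
    have h2 : t ∈ q.asIdeal := by
      apply Module.annihilator_le_of_mem_support hq
      rw [Module.mem_annihilator]
      intro m
      obtain ⟨m, rfl⟩ := Submodule.mkQ_surjective _ m
      rw [← _root_.map_smul]
      simp only [Submodule.mkQ_apply, Submodule.Quotient.mk_eq_zero]
      exact ⟨m, rfl⟩
    exact lt_of_mem hd (lt_of_le_of_ne h1 (by rintro rfl; exact ht h2))
  obtain ⟨z, rfl⟩ := (T.exact_mid d R'.subtype R'.mkQ (Submodule.subtype_injective _)
    (Submodule.mkQ_surjective _) (LinearMap.exact_subtype_mkQ R') x).1 (Subsingleton.elim _ _)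
  obtain ⟨y, rfl⟩ := T.map_surj d hd (mulS M t).rangeRestrict (LinearMap.surjective_rangeRestrict _) z
  refine ⟨y, ?_⟩
  rw [← T.smul_apply, ← LinearMap.comp_apply, ← T.map_comp]
  rfl

section E
variable [IsLocalRing S] (E : Type u) [AddCommGroup E] [Module S E] [Module.Injective S E]

theorem good_k (hk : Module.Finite S ((S ⧸ IsLocalRing.maximalIdeal S) →ₗ[S] E))
    (Z : Set (PrimeSpectrum S)) (hZ : IsLocalRing.closedPoint S ∈ Z) :
    Good (IsLocalRing.maximalIdeal S) E Z (S ⧸ IsLocalRing.maximalIdeal S) := by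
  have key : ∀ r ∈ IsLocalRing.maximalIdeal S, ∀ x : S ⧸ IsLocalRing.maximalIdeal S,
      r • x = 0 := by
    intro r hr x
    obtain ⟨x, rfl⟩ := Ideal.Quotient.mk_surjective x
    change Ideal.Quotient.mk _ (r * x) = 0
    rw [Ideal.Quotient.eq_zero_iff_mem]
    exact Ideal.mul_mem_right _ _ hr
  refine ⟨fun x => ⟨1, fun r hr => key r (by simpa using hr) x⟩, hk, ?_⟩
  intro q hq
  have h1 : IsLocalRing.maximalIdeal S ≤ q.asIdeal := by
    intro r hr
    apply Module.annihilator_le_of_mem_support hq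
    rw [Module.mem_annihilator]
    intro φ
    ext
    rw [LinearMap.comp_apply, LinearMap.smul_apply, ← _root_.map_smul, key r hr, _root_.map_zero]
    rfl
  have : q = IsLocalRing.closedPoint S := by
    apply PrimeSpectrum.ext
    exact le_antisymm (IsLocalRing.le_maximalIdeal q.2.ne_top) h1
  rwa [this]

theorem sub_zero (p : PrimeSpectrum S) {s : S} (hs : s ∈ b) (hsp : s ∉ p.asIdeal) :
    Subsingleton (T.obj 0 (S ⧸ p.asIdeal)) := by
  apply T.subsingleton_of_inj _ hs
  intro x hx
  rw [← T.smul_apply] at hx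
  exact (injective_iff_map_eq_zero _).1 (T.inj_zero _ (mulS_inj p hsp)) x hx

theorem van_p (p : PrimeSpectrum S) (hbp : b ≤ p.asIdeal) (i : ℕ) :
    Subsingleton (T.obj (i + 1) (S ⧸ p.asIdeal)) := by
  apply T.van
  intro r hr m
  obtain ⟨m, rfl⟩ := Ideal.Quotient.mk_surjective m
  change Ideal.Quotient.mk p.asIdeal (r * m) = 0
  rw [Ideal.Quotient.eq_zero_iff_mem]
  exact Ideal.mul_mem_right _ _ (hbp hr)

theorem step_lc [IsPrecomplete (IsLocalRing.maximalIdeal S) S]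
    (hb : b ≤ IsLocalRing.maximalIdeal S) (p : PrimeSpectrum S) {s : S} (hs : s ∈ b)
    (hsp : s ∉ p.asIdeal) (i : ℕ) (Z : Set (PrimeSpectrum S))
    (h : Good (IsLocalRing.maximalIdeal S) E Z
      (T.obj i ((S ⧸ p.asIdeal) ⧸ LinearMap.range (mulS (S ⧸ p.asIdeal) s)))) :
    Good (IsLocalRing.maximalIdeal S) E
      {q | ∀ q' : PrimeSpectrum S, q ≤ q' → s ∈ q'.asIdeal → q' ∈ Z}
      (T.obj (i + 1) (S ⧸ p.asIdeal)) := by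
  apply Good.step (hb hs)
  · intro x
    obtain ⟨k, hk⟩ := T.tors _ _ x
    exact ⟨k, hk _ (Ideal.pow_mem_pow hs k)⟩
  · obtain ⟨δ, -, h2⟩ := T.del_quot i (mulS (S ⧸ p.asIdeal) s) (mulS_inj p hsp)
    have h3 : ∀ y, δ y ∈ LinearMap.ker (mulS (T.obj (i + 1) (S ⧸ p.asIdeal)) s) := by
      intro y
      rw [LinearMap.mem_ker]
      have := h2.apply_apply_eq_zero y
      rw [T.smul_apply] at this
      exact this
    refine Good.of_surj (LinearMap.codRestrict _ δ h3) ?_ h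
    rintro ⟨x, hx⟩
    have hx' : T.map (i + 1) (mulS (S ⧸ p.asIdeal) s) x = 0 := by
      rw [T.smul_apply]; exact hx
    obtain ⟨y, rfl⟩ := (h2 x).1 hx'
    exact ⟨y, rfl⟩

theorem good_zero (hk : Module.Finite S ((S ⧸ IsLocalRing.maximalIdeal S) →ₗ[S] E))
    [IsPrecomplete (IsLocalRing.maximalIdeal S) S] (hb : b ≤ IsLocalRing.maximalIdeal S)
    (p : PrimeSpectrum S) (hbp : p = IsLocalRing.closedPoint S)
    (Z : Set (PrimeSpectrum S)) (hZ : IsLocalRing.closedPoint S ∈ Z) :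
    Good (IsLocalRing.maximalIdeal S) E Z (T.obj 0 (S ⧸ p.asIdeal)) := by
  subst hbp
  obtain ⟨f, hf⟩ := T.emb (S ⧸ (IsLocalRing.closedPoint S).asIdeal)
  exact Good.of_inj f hf (good_k E hk Z hZ)

theorem dim_zero_eq (hk : Module.Finite S ((S ⧸ IsLocalRing.maximalIdeal S) →ₗ[S] E))
    [IsPrecomplete (IsLocalRing.maximalIdeal S) S] (hb : b ≤ IsLocalRing.maximalIdeal S)
    (p : PrimeSpectrum S) (h : ringKrullDim (S ⧸ p.asIdeal) ≤ 0) :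
    p = IsLocalRing.closedPoint S := by
  by_contra hne
  have hlt : p < IsLocalRing.closedPoint S :=
    lt_of_le_of_ne (IsLocalRing.le_maximalIdeal p.2.ne_top) hne
  have h1 := (krull_lt_of_lt hlt).trans h
  have h0 : (0 : WithBot ℕ∞) ≤ ringKrullDim (S ⧸ (IsLocalRing.closedPoint S).asIdeal) :=
    ringKrullDim_nonneg_of_nontrivial
  have h2 : (0 : WithBot ℕ∞) + 1 ≤ ringKrullDim (S ⧸ (IsLocalRing.closedPoint S).asIdeal) + 1 := by
    gcongr
  have h3 := h2.trans h1
  simp at h3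
  exact wb_one_le_zero h3

theorem good1 (hk : Module.Finite S ((S ⧸ IsLocalRing.maximalIdeal S) →ₗ[S] E))
    [IsPrecomplete (IsLocalRing.maximalIdeal S) S] (hb : b ≤ IsLocalRing.maximalIdeal S)
    (d : ℕ) : ∀ (M : Type u) [AddCommGroup M] [Module S M] [Module.Finite S M],
    (Module.support S M ⊆ {p | ringKrullDim (S ⧸ p.asIdeal) ≤ (d : WithBot ℕ∞)}) →
    Good (IsLocalRing.maximalIdeal S) E
      {q | b ≤ q.asIdeal → q = IsLocalRing.closedPoint S} (T.obj d M) := by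
  induction d with
  | zero =>
    intro M _ _ _ hM
    refine devissage _ (fun N _ _ => Good (IsLocalRing.maximalIdeal S) E
      {q | b ≤ q.asIdeal → q = IsLocalRing.closedPoint S} (T.obj 0 N)) ?_ ?_ ?_ M hM
    · intro N _ _ _
      have := T.subsingleton_of_subsingleton (M := N) 0
      exact Good.of_subsingleton
    · intro p hp
      have h1 := hp p le_rfl
      exact T.good_zero E hk hb p (dim_zero_eq E hk hb p (by simpa using h1)) _ (fun _ => rfl)
    · intro N₁ N₂ N₃ _ _ _ _ _ _ f g hf hg hfg h1 h3
      exact Good.of_exact _ _ (T.exact_mid 0 f g hf hg hfg) h1 h3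
  | succ d ih =>
    intro M _ _ _ hM
    refine devissage _ (fun N _ _ => Good (IsLocalRing.maximalIdeal S) E
      {q | b ≤ q.asIdeal → q = IsLocalRing.closedPoint S} (T.obj (d + 1) N)) ?_ ?_ ?_ M hM
    · intro N _ _ _
      have := T.subsingleton_of_subsingleton (M := N) (d + 1)
      exact Good.of_subsingleton
    · intro p hp
      by_cases hbp : b ≤ p.asIdeal
      · have := T.van_p p hbp d
        exact Good.of_subsingleton
      · obtain ⟨s, hs, hsp⟩ := SetLike.not_le_iff_exists.1 hbp
        refine Good.mono ?_ (T.step_lc E hb p hs hsp d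
          {q | b ≤ q.asIdeal → q = IsLocalRing.closedPoint S} (ih _ ?_))
        · intro q hq hbq
          exact hq q le_rfl (hbq hs) hbq
        · intro q hq
          obtain ⟨h3, h4⟩ := supp_modS p s hq
          have h5 : p < q := lt_of_le_of_ne h3 (by rintro rfl; exact hsp h4)
          have h6 := (krull_lt_of_lt h5).trans (hp p le_rfl)
          push_cast at h6
          exact wb_le_of_add _ _ h6
    · intro N₁ N₂ N₃ _ _ _ _ _ _ f g hf hg hfg h1 h3
      exact Good.of_exact _ _ (T.exact_mid _ f g hf hg hfg) h1 h3

theorem good2 (hk : Module.Finite S ((S ⧸ IsLocalRing.maximalIdeal S) →ₗ[S] E))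
    [IsPrecomplete (IsLocalRing.maximalIdeal S) S] (hb : b ≤ IsLocalRing.maximalIdeal S)
    (d : ℕ) : ∀ (M : Type u) [AddCommGroup M] [Module S M] [Module.Finite S M],
    (Module.support S M ⊆ {q | b ≤ q.asIdeal → q = IsLocalRing.closedPoint S}) →
    Good (IsLocalRing.maximalIdeal S) E
      {p | ringKrullDim (S ⧸ p.asIdeal) ≤ (d : WithBot ℕ∞)} (T.obj d M) := by
  induction d with
  | zero =>
    intro M _ _ _ hM
    refine devissage _ (fun N _ _ => Good (IsLocalRing.maximalIdeal S) E
      {p | ringKrullDim (S ⧸ p.asIdeal) ≤ ((0 : ℕ) : WithBot ℕ∞)} (T.obj 0 N)) ?_ ?_ ?_ M hM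
    · intro N _ _ _
      have := T.subsingleton_of_subsingleton (M := N) 0
      exact Good.of_subsingleton
    · intro p hp
      by_cases hbp : b ≤ p.asIdeal
      · refine T.good_zero E hk hb p (hp p le_rfl hbp) _ ?_
        have : IsField (S ⧸ (IsLocalRing.closedPoint S).asIdeal) :=
          (Ideal.Quotient.maximal_ideal_iff_isField_quotient _).1
            (IsLocalRing.maximalIdeal.isMaximal S)
        simp [ringKrullDim_eq_zero_of_isField this]
      · obtain ⟨s, hs, hsp⟩ := SetLike.not_le_iff_exists.1 hbp
        have := T.sub_zero p hs hsp
        exact Good.of_subsingleton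
    · intro N₁ N₂ N₃ _ _ _ _ _ _ f g hf hg hfg h1 h3
      exact Good.of_exact _ _ (T.exact_mid 0 f g hf hg hfg) h1 h3
  | succ d ih =>
    intro M _ _ _ hM
    refine devissage _ (fun N _ _ => Good (IsLocalRing.maximalIdeal S) E
      {p | ringKrullDim (S ⧸ p.asIdeal) ≤ ((d + 1 : ℕ) : WithBot ℕ∞)} (T.obj (d + 1) N))
      ?_ ?_ ?_ M hM
    · intro N _ _ _
      have := T.subsingleton_of_subsingleton (M := N) (d + 1)
      exact Good.of_subsingleton
    · intro p hp
      by_cases hbp : b ≤ p.asIdeal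
      · have := T.van_p p hbp d
        exact Good.of_subsingleton
      · obtain ⟨s, hs, hsp⟩ := SetLike.not_le_iff_exists.1 hbp
        refine Good.mono ?_ (T.step_lc E hb p hs hsp d
          {p | ringKrullDim (S ⧸ p.asIdeal) ≤ (d : WithBot ℕ∞)} (ih _ ?_))
        · intro q hq
          exact dim_le_succ q s (hb hs) d hq
        · intro q hq
          obtain ⟨h3, h4⟩ := supp_modS p s hq
          exact hp q h3
    · intro N₁ N₂ N₃ _ _ _ _ _ _ f g hf hg hfg h1 h3
      exact Good.of_exact _ _ (T.exact_mid _ f g hf hg hfg) h1 h3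

end E
end LCT


set_option linter.unusedSectionVars false

section faith
variable {S : Type u} [CommRing S] [IsNoetherianRing S] [IsLocalRing S]
variable (E : Type u) [AddCommGroup E] [Module S E] [Module.Injective S E]

theorem dual_nontrivial (he : ∃ e : E, e ≠ 0 ∧ ∀ r ∈ IsLocalRing.maximalIdeal S, r • e = 0)
    (B : Type u) [AddCommGroup B] [Module S B] (x : B) (hx : x ≠ 0) :
    ∃ φ : B →ₗ[S] E, φ x ≠ 0 := by
  obtain ⟨e, he0, he⟩ := he
  have hker : LinearMap.ker (LinearMap.toSpanSingleton S B x) ≤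
      LinearMap.ker (LinearMap.toSpanSingleton S E e) := by
    intro r hr
    simp only [LinearMap.mem_ker, LinearMap.toSpanSingleton_apply] at hr ⊢
    apply he
    intro hu
    apply hx
    obtain ⟨y, hy⟩ := isUnit_iff_exists_inv'.1 hu
    rw [← one_smul S x, ← hy, mul_smul, hr, smul_zero]
  let f := (LinearMap.ker (LinearMap.toSpanSingleton S B x)).liftQ _ hker
  let g := (LinearMap.ker (LinearMap.toSpanSingleton S B x)).liftQ
    (LinearMap.toSpanSingleton S B x) le_rfl
  have hg : Function.Injective g := by
    rw [← LinearMap.ker_eq_bot]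
    exact Submodule.ker_liftQ_eq_bot _ _ _ le_rfl
  obtain ⟨φ, hφ⟩ := Module.Injective.extension_property S E _ B g hg f
  refine ⟨φ, ?_⟩
  have h1 : φ ((1 : S) • x) = (1 : S) • e := LinearMap.congr_fun hφ (Submodule.Quotient.mk 1)
  rw [one_smul, one_smul] at h1
  rwa [h1]

end faith

namespace LCT
variable {S : Type u} [CommRing S] [IsNoetherianRing S] {b : Ideal S} (T : LCT S b)
variable [IsLocalRing S] (E : Type u) [AddCommGroup E] [Module S E] [Module.Injective S E]

theorem mem_supp_dual (he : ∃ e : E, e ≠ 0 ∧ ∀ r ∈ IsLocalRing.maximalIdeal S, r • e = 0)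
    (d : ℕ) (hd : ringKrullDim S ≤ (d : WithBot ℕ∞)) {M : Type u} [AddCommGroup M] [Module S M]
    [Module.Finite S M] (p : PrimeSpectrum S) (hM : ∀ q ∈ Module.support S M, p ≤ q)
    (hn : Nontrivial (T.obj d M)) (hf : Module.Finite S (T.obj d M →ₗ[S] E)) :
    p ∈ Module.support S (T.obj d M →ₗ[S] E) := by
  rw [Module.mem_support_iff_of_finite]
  intro t ht
  by_contra htp
  obtain ⟨x, hx⟩ := exists_ne (0 : T.obj d M)
  obtain ⟨φ, hφ⟩ := dual_nontrivial E he _ x hx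
  obtain ⟨y, rfl⟩ := T.smul_surj d hd p hM t htp x
  apply hφ
  rw [Module.mem_annihilator] at ht
  have := LinearMap.congr_fun (ht φ) y
  rw [_root_.map_smul]
  exact this

theorem supp_quot_le (hk : Module.Finite S ((S ⧸ IsLocalRing.maximalIdeal S) →ₗ[S] E))
    [IsPrecomplete (IsLocalRing.maximalIdeal S) S] (hb : b ≤ IsLocalRing.maximalIdeal S)
    {p : PrimeSpectrum S} : ∀ q ∈ Module.support S (S ⧸ p.asIdeal), p ≤ q := by
  intro q hq
  rw [Module.support_eq_zeroLocus, Ideal.annihilator_quotient] at hq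
  exact hq

theorem main_complete (hk : Module.Finite S ((S ⧸ IsLocalRing.maximalIdeal S) →ₗ[S] E))
    [IsPrecomplete (IsLocalRing.maximalIdeal S) S] (hb : b ≤ IsLocalRing.maximalIdeal S)
    (he : ∃ e : E, e ≠ 0 ∧ ∀ r ∈ IsLocalRing.maximalIdeal S, r • e = 0)
    (d : ℕ) (hd : ringKrullDim S ≤ (d : WithBot ℕ∞)) (U : Type u) [AddCommGroup U] [Module S U]
    [Module.Finite S U] (j : U →ₗ[S] S) (hj : Function.Injective j)
    (hz : ∀ (u : U) (x : T.obj d S), j u • x = 0) : Subsingleton (T.obj d U) := by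
  have hdim : ∀ q : PrimeSpectrum S, ringKrullDim (S ⧸ q.asIdeal) ≤ (d : WithBot ℕ∞) :=
    fun q => (ringKrullDim_quotient_le _).trans hd
  refine devissage (Module.support S U) (fun N _ _ => Subsingleton (T.obj d N)) ?_ ?_ ?_ U le_rfl
  · intro N _ _ _
    exact T.subsingleton_of_subsingleton _
  swap
  · intro N₁ N₂ N₃ _ _ _ _ _ _ f g hf hg hfg h1 h3
    exact T.mid_subsingleton _ f g hf hg hfg h1 h3
  intro p hp
  by_contra hns
  rw [not_subsingleton_iff_nontrivial] at hns
  have hpU := hp p le_rfl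
  have hdp : (d : WithBot ℕ∞) ≤ ringKrullDim (S ⧸ p.asIdeal) := by
    by_contra hlt
    rw [not_le] at hlt
    apply not_subsingleton (T.obj d (S ⧸ p.asIdeal))
    apply T.vanish
    intro q hq
    have hq' := supp_quot_le E hk hb q hq
    rcases eq_or_lt_of_le hq' with rfl | h
    · exact hlt
    · exact lt_of_mem hd h
  have hmin : p.asIdeal ∈ minimalPrimes S := by
    refine ⟨⟨p.2, bot_le⟩, ?_⟩
    rintro q ⟨hq, -⟩ hqp
    by_contra hne
    have hlt : (⟨q, hq⟩ : PrimeSpectrum S) < p :=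
      lt_of_le_of_ne hqp (by rintro h; apply hne; rw [← h])
    exact absurd hdp (not_le.2 (lt_of_mem hd hlt))
  have hg1 : ∀ (M : Type u) [AddCommGroup M] [Module S M] [Module.Finite S M],
      Good (IsLocalRing.maximalIdeal S) E
        {q | b ≤ q.asIdeal → q = IsLocalRing.closedPoint S} (T.obj d M) :=
    fun M _ _ _ => T.good1 E hk hb d M (fun q _ => hdim q)
  -- Lichtenbaum–Hartshorne
  have hLH : ∀ q : PrimeSpectrum S, p ≤ q → b ≤ q.asIdeal → q = IsLocalRing.closedPoint S := by
    intro q hq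
    have h1 := hg1 (S ⧸ p.asIdeal)
    have h2 := T.mem_supp_dual E he d hd p (supp_quot_le E hk hb) hns h1.2.1
    exact h1.2.2 (Module.mem_support_mono hq h2)
  rw [Module.mem_support_iff'] at hpU
  obtain ⟨u, hu⟩ := hpU
  set x := j u with hx
  have hxr : ∀ r ∉ p.asIdeal, r * x ≠ 0 := by
    intro r hr h0
    apply hu r hr
    apply hj
    rw [_root_.map_smul, _root_.map_zero]
    exact h0
  let J : Ideal S := RingHom.ker (algebraMap S (Localization.AtPrime p.asIdeal))
  have hJ : ∀ t, t ∈ J ↔ ∃ m ∉ p.asIdeal, m * t = 0 := by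
    intro t
    rw [RingHom.mem_ker, IsLocalization.map_eq_zero_iff p.asIdeal.primeCompl]
    constructor
    · rintro ⟨m, hm⟩; exact ⟨m.1, m.2, hm⟩
    · rintro ⟨m, hm, h⟩; exact ⟨⟨m, hm⟩, h⟩
  have hJp : J ≤ p.asIdeal := by
    intro t ht
    obtain ⟨m, hm, h⟩ := (hJ t).1 ht
    exact (p.2.mem_or_mem (show m * t ∈ p.asIdeal by rw [h]; exact zero_mem _)).resolve_left hm
  have hpJ : ∀ q : PrimeSpectrum S, J ≤ q.asIdeal → p ≤ q := by
    intro q hq t ht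
    have := Ring.KrullDimLE.of_isLocalization p.asIdeal hmin (Localization.AtPrime p.asIdeal)
    have h1 : IsNilpotent (algebraMap S (Localization.AtPrime p.asIdeal) t) := by
      rw [Ring.KrullDimLE.isNilpotent_iff_mem_maximalIdeal]
      exact (IsLocalization.AtPrime.to_map_mem_maximal_iff _ p.asIdeal t).2 ht
    obtain ⟨k, hk⟩ := h1
    rw [← map_pow] at hk
    exact q.2.mem_of_pow_mem k (hq hk)
  let M := S ⧸ J
  let M' := LinearMap.range (mulS M x)
  have hsuppM : ∀ q ∈ Module.support S M, p ≤ q := by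
    intro q hq
    rw [Module.support_eq_zeroLocus, Ideal.annihilator_quotient] at hq
    exact hpJ q hq
  have hsuppM' : ∀ q ∈ Module.support S M', p ≤ q := fun q hq =>
    hsuppM q (Module.support_subset_of_injective _ M'.subtype_injective hq)
  have hι : T.map d M'.subtype = 0 := by
    ext z
    obtain ⟨y, rfl⟩ := T.map_surj d hd (mulS M x).rangeRestrict
      (LinearMap.surjective_rangeRestrict _) z
    obtain ⟨w, rfl⟩ := T.map_surj d hd (Submodule.mkQ J) (Submodule.mkQ_surjective _) y
    rw [← LinearMap.comp_apply, ← T.map_comp]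
    change T.map d (mulS M x) _ = 0
    rw [T.smul_apply, ← _root_.map_smul, hz, _root_.map_zero]
  -- surjection onto `S/p`
  have hM'n : Nontrivial (T.obj d M') := by
    let f : M →ₗ[S] S ⧸ p.asIdeal := Submodule.factor hJp
    have hfs : Function.Surjective f := Submodule.factor_surjective hJp
    have hker : LinearMap.ker (mulS M x) ≤ LinearMap.ker f := by
      intro m hm
      obtain ⟨t, rfl⟩ := Submodule.mkQ_surjective _ m
      rw [LinearMap.mem_ker] at hm
      have h1 : x * t ∈ J := by
        rw [← Ideal.Quotient.eq_zero_iff_mem]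
        exact hm
      obtain ⟨m, hm, h⟩ := (hJ _).1 h1
      have h2 : t ∈ p.asIdeal := by
        by_contra htp
        refine hxr (m * t) ?_ (by rw [← h]; ring)
        exact p.asIdeal.primeCompl.mul_mem hm htp
      exact (Ideal.Quotient.eq_zero_iff_mem).2 h2
    let g : M' →ₗ[S] S ⧸ p.asIdeal :=
      (LinearMap.ker (mulS M x)).liftQ f hker ∘ₗ (mulS M x).quotKerEquivRange.symm.toLinearMap
    have hg : Function.Surjective g := by
      rw [LinearMap.coe_comp]
      refine Function.Surjective.comp ?_ (LinearEquiv.surjective _)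
      intro y
      obtain ⟨z, rfl⟩ := hfs y
      exact ⟨Submodule.Quotient.mk z, rfl⟩
    exact (T.map_surj d hd g hg).nontrivial
  cases d with
  | zero =>
    have h1 := T.inj_zero M'.subtype M'.subtype_injective
    rw [hι] at h1
    obtain ⟨y, hy⟩ := exists_ne (0 : T.obj 0 M')
    exact hy (h1 rfl)
  | succ k =>
    obtain ⟨δ, -, h2⟩ := T.del_quot k M'.subtype M'.subtype_injective
    have hδ : Function.Surjective δ := by
      intro y
      exact (h2 y).1 (by rw [hι]; rfl)
    have h3 := T.good2 E hk hb k (M ⧸ LinearMap.range M'.subtype) (by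
      intro q hq
      exact hLH q (hsuppM q (Module.support_subset_of_surjective _
        (Submodule.mkQ_surjective _) hq)))
    have h4 := Good.of_surj δ hδ h3
    have h5 := T.mem_supp_dual E he (k + 1) hd p hsuppM' hM'n h4.2.1
    have h6 : ringKrullDim (S ⧸ p.asIdeal) ≤ (k : WithBot ℕ∞) := h4.2.2 h5
    have h7 := hdp.trans h6
    have h8 : k + 1 ≤ k := by exact_mod_cast h7
    omega

end LCT


set_option linter.unusedSectionVars false

theorem exists_inj_embed (S : Type u) [CommRing S] (M : Type u) [AddCommGroup M] [Module S M] :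
    ∃ (I : ModuleCat.{u} S) (f : M →ₗ[S] I), Module.Injective S I ∧ Function.Injective f := by
  refine ⟨Injective.under (ModuleCat.of S M), (Injective.ι (ModuleCat.of S M)).hom, ?_, ?_⟩
  · refine ⟨fun A B _ _ _ _ f hf g => ?_⟩
    have : Mono (ModuleCat.ofHom f) := (ModuleCat.mono_iff_injective _).2 hf
    obtain ⟨l, h⟩ := Injective.factors (J := Injective.under (ModuleCat.of S M))
      (ModuleCat.ofHom g) (ModuleCat.ofHom f)
    exact ⟨l.hom, fun x => congrArg (fun q => q.hom x) h⟩
  · exact (ModuleCat.mono_iff_injective _).1 inferInstance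

theorem exists_hull (S : Type u) [CommRing S] [IsNoetherianRing S] [IsLocalRing S] :
    ∃ E : ModuleCat.{u} S, Module.Injective S E ∧
      Module.Finite S ((S ⧸ IsLocalRing.maximalIdeal S) →ₗ[S] E) ∧
      ∃ e : E, e ≠ 0 ∧ ∀ r ∈ IsLocalRing.maximalIdeal S, r • e = 0 := by
  obtain ⟨I, ι, hI, hι⟩ := exists_inj_embed S (S ⧸ IsLocalRing.maximalIdeal S)
  let e : I := ι 1
  have he0 : e ≠ 0 := fun h => one_ne_zero (hι (h.trans (map_zero ι).symm))
  have he : ∀ r ∈ IsLocalRing.maximalIdeal S, r • e = 0 := by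
    intro r hr
    rw [← map_smul]
    have : r • (1 : S ⧸ IsLocalRing.maximalIdeal S) = 0 := by
      rw [← map_one (Ideal.Quotient.mk (IsLocalRing.maximalIdeal S))]
      change Ideal.Quotient.mk _ (r * 1) = 0
      rw [Ideal.Quotient.eq_zero_iff_mem]
      simpa using hr
    rw [this, map_zero]
  let k₀ : Submodule S I := Submodule.span S {e}
  let X : Set (Submodule S I) :=
    {F | k₀ ≤ F ∧ ∀ x ∈ F, x ≠ 0 → ∃ r : S, r • x ≠ 0 ∧ r • x ∈ k₀}
  obtain ⟨F, hkF, hFmax⟩ := zorn_le_nonempty₀ X (by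
    intro c hc hch y hy
    refine ⟨sSup c, ⟨(hc hy).1.trans (le_sSup hy), ?_⟩, fun z hz => le_sSup hz⟩
    intro x hx hx0
    rw [Submodule.mem_sSup_of_directed ⟨y, hy⟩ hch.directedOn] at hx
    obtain ⟨z, hz, hxz⟩ := hx
    exact (hc hz).2 x hxz hx0) k₀ ⟨le_rfl, fun x hx hx0 => ⟨1, by simpa using hx0, by simpa using hx⟩⟩
  have hF := hFmax.prop
  obtain ⟨C, -, hCmax⟩ := zorn_le_nonempty₀ {C : Submodule S I | ∀ x ∈ C, x ∈ F → x = 0} (by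
    intro c hc hch y hy
    refine ⟨sSup c, ?_, fun z hz => le_sSup hz⟩
    intro x hx hxF
    rw [Submodule.mem_sSup_of_directed ⟨y, hy⟩ hch.directedOn] at hx
    obtain ⟨z, hz, hxz⟩ := hx
    exact hc hz x hxz hxF) ⊥ (by intro x hx _; simpa using hx)
  have hC := hCmax.prop
  have hess : ∀ y ∉ C, ∃ (r : S) (z : I), z ∈ F ∧ z ≠ 0 ∧ z - r • y ∈ C := by
    intro y hy
    by_contra hcon
    push Not at hcon
    have h1 : C ⊔ Submodule.span S {y} ≤ C := hCmax.le_of_ge (by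
      intro x hx hxF
      obtain ⟨c, hc, w, hw, rfl⟩ := Submodule.mem_sup.1 hx
      obtain ⟨r, rfl⟩ := Submodule.mem_span_singleton.1 hw
      by_contra hne
      exact hcon r _ hxF hne (by simpa using hc)) le_sup_left
    exact hy (h1 (Submodule.mem_sup_right (Submodule.mem_span_singleton_self y)))
  let j : F →ₗ[S] I ⧸ C := C.mkQ ∘ₗ F.subtype
  have hj : Function.Injective j := by
    rw [injective_iff_map_eq_zero]
    rintro ⟨x, hx⟩ h
    have : x ∈ C := (Submodule.Quotient.mk_eq_zero C).1 h
    exact Subtype.ext (hC x this hx)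
  obtain ⟨ψ, hψ⟩ := Module.Injective.extension_property S I F (I ⧸ C) j hj F.subtype
  have hψz : ∀ z ∈ F, ψ (C.mkQ z) = z := fun z hz => LinearMap.congr_fun hψ ⟨z, hz⟩
  have hess' : ∀ y : I, y ∉ C → ∃ r : S, r • ψ (C.mkQ y) ≠ 0 ∧ r • ψ (C.mkQ y) ∈ F := by
    intro y hy
    obtain ⟨r, z, hz, hz0, hzr⟩ := hess y hy
    have h1 : r • ψ (C.mkQ y) = z := by
      rw [← map_smul, ← map_smul, ← hψz z hz]
      congr 1
      symm
      exact (Submodule.Quotient.eq C).2 hzr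
    exact ⟨r, by rwa [h1], by rwa [h1]⟩
  have hrange : LinearMap.range ψ ≤ F := hFmax.le_of_ge (by
    refine ⟨?_, ?_⟩
    · intro x hx
      exact ⟨C.mkQ x, hψz x (hF.1 hx)⟩
    · rintro _ ⟨y, rfl⟩ hy0
      obtain ⟨y, rfl⟩ := Submodule.mkQ_surjective _ y
      have hy : y ∉ C := by
        intro hy
        apply hy0
        rw [show C.mkQ y = 0 from (Submodule.Quotient.mk_eq_zero C).2 hy, map_zero]
      obtain ⟨r, hr, hrF⟩ := hess' y hy
      obtain ⟨t, ht, htk⟩ := hF.2 _ hrF hr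
      exact ⟨t * r, by rwa [mul_smul], by rwa [mul_smul]⟩)
    (fun x hx => ⟨C.mkQ x, hψz x hx⟩)
  let π : I →ₗ[S] F := LinearMap.codRestrict F (ψ ∘ₗ C.mkQ) (fun x => hrange ⟨_, rfl⟩)
  have hπ : ∀ z : F, π z = z := fun z => Subtype.ext (hψz z z.2)
  refine ⟨ModuleCat.of S F, ?_, ?_, ⟨e, hkF (Submodule.mem_span_singleton_self e)⟩, ?_, ?_⟩
  · refine ⟨fun A B _ _ _ _ f hf g => ?_⟩
    obtain ⟨h, hh⟩ := Module.Injective.extension_property S I A B f hf (F.subtype ∘ₗ g)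
    refine ⟨π ∘ₗ h, fun x => ?_⟩
    have := LinearMap.congr_fun hh x
    simp only [LinearMap.comp_apply] at this ⊢
    rw [this]
    exact hπ (g x)
  · let ev : ((S ⧸ IsLocalRing.maximalIdeal S) →ₗ[S] F) →ₗ[S] I :=
      F.subtype ∘ₗ LinearMap.applyₗ (1 : S ⧸ IsLocalRing.maximalIdeal S)
    have hev : Function.Injective ev := by
      intro φ φ' h
      ext
      exact h
    have hk : ∀ φ, ev φ ∈ k₀ := by
      intro φ
      by_cases h0 : ev φ = 0
      · rw [h0]; exact zero_mem _
      · obtain ⟨r, hr, hrk⟩ := hF.2 (ev φ) (φ 1).2 h0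
        have hu : IsUnit r := by
          by_contra hu
          apply hr
          rw [← map_smul]
          have : r • φ = 0 := by
            ext
            change ((r • φ (1 : S ⧸ IsLocalRing.maximalIdeal S) : F) : I) = 0
            rw [← map_smul]
            have : r • (1 : S ⧸ IsLocalRing.maximalIdeal S) = 0 := by
              rw [← map_one (Ideal.Quotient.mk (IsLocalRing.maximalIdeal S))]
              change Ideal.Quotient.mk _ (r * 1) = 0
              rw [Ideal.Quotient.eq_zero_iff_mem]
              simpa using hu
            rw [this, map_zero]
            rfl
          rw [this, map_zero]
        obtain ⟨y, hy⟩ := isUnit_iff_exists_inv'.1 hu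
        have := k₀.smul_mem y hrk
        rwa [smul_smul, hy, one_smul] at this
    exact Module.Finite.of_injective (LinearMap.codRestrict k₀ ev hk)
      (fun a c h => hev (by have := congrArg (fun z : k₀ => (z : I)) h; exact this))
  · intro h
    exact he0 (congrArg Subtype.val h)
  · intro r hr
    exact Subtype.ext (he r hr)


set_option linter.unusedSectionVars false

section Loc
variable {S : Type u} [CommRing S]

/-- Localization of a module at the powers of an element. -/
abbrev Loc (f : S) (X : Type u) [AddCommGroup X] [Module S X] : Type u :=
  LocalizedModule (Submonoid.powers f) X

noncomputable def lι (f : S) (X : Type u) [AddCommGroup X] [Module S X] : X →ₗ[S] Loc f X :=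
  LocalizedModule.mkLinearMap (Submonoid.powers f) X

variable {X Y Z : Type u} [AddCommGroup X] [Module S X] [AddCommGroup Y] [Module S Y]
  [AddCommGroup Z] [Module S Z]

instance (f : S) : IsLocalizedModule (Submonoid.powers f) (lι f X) :=
  inferInstanceAs (IsLocalizedModule _ (LocalizedModule.mkLinearMap (Submonoid.powers f) X))

noncomputable def lmap (f : S) (g : X →ₗ[S] Y) : Loc f X →ₗ[S] Loc f Y :=
  IsLocalizedModule.map (Submonoid.powers f) (lι f X) (lι f Y) g

@[simp] theorem lmap_lι (f : S) (g : X →ₗ[S] Y) (x : X) : lmap f g (lι f X x) = lι f Y (g x) :=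
  IsLocalizedModule.map_apply (Submonoid.powers f) (lι f X) (lι f Y) g x

theorem Loc.exists_pow (f : S) (y : Loc f X) : ∃ (k : ℕ) (x : X), f ^ k • y = lι f X x := by
  obtain ⟨⟨x, ⟨_, k, rfl⟩⟩, h⟩ := IsLocalizedModule.surj (Submonoid.powers f) (lι f X) y
  exact ⟨k, x, h⟩

theorem lι_eq_zero (f : S) (x : X) : lι f X x = 0 ↔ ∃ m : ℕ, f ^ m • x = 0 := by
  rw [IsLocalizedModule.eq_zero_iff (Submonoid.powers f) (lι f X)]
  constructor
  · rintro ⟨⟨_, k, rfl⟩, h⟩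
    exact ⟨k, h⟩
  · rintro ⟨k, h⟩
    exact ⟨⟨_, k, rfl⟩, h⟩

theorem Loc.pow_inj (f : S) (k : ℕ) {y z : Loc f X} (h : f ^ k • y = f ^ k • z) : y = z :=
  (IsLocalizedModule.smul_inj (lι f X) (⟨f ^ k, k, rfl⟩ : Submonoid.powers f) y z).1 h

theorem Loc.pow_surj (f : S) (k : ℕ) (y : Loc f X) : ∃ z, f ^ k • z = y := by
  have := (Module.End.isUnit_iff _).1
    (IsLocalizedModule.map_units (lι f X) (⟨f ^ k, k, rfl⟩ : Submonoid.powers f))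
  obtain ⟨z, hz⟩ := this.2 y
  exact ⟨z, hz⟩

theorem Loc.hom_ext (f : S) {g h : Loc f X →ₗ[S] Loc f Y}
    (H : ∀ x, g (lι f X x) = h (lι f X x)) : g = h := by
  ext y
  obtain ⟨k, x, hx⟩ := Loc.exists_pow f y
  apply Loc.pow_inj f k
  rw [← map_smul, ← map_smul, hx, H]

theorem lmap_comp (f : S) (g : X →ₗ[S] Y) (h : Y →ₗ[S] Z) :
    lmap f (h ∘ₗ g) = lmap f h ∘ₗ lmap f g :=
  Loc.hom_ext f (by simp)

theorem lmap_smul_id (f s : S) :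
    lmap f (s • (LinearMap.id : X →ₗ[S] X)) = s • LinearMap.id :=
  Loc.hom_ext f (by simp)

theorem lmap_zero (f : S) : lmap f (0 : X →ₗ[S] Y) = 0 :=
  Loc.hom_ext f (by simp)

theorem lmap_inj (f : S) (g : X →ₗ[S] Y) (h : Function.Injective g) :
    Function.Injective (lmap f g) :=
  IsLocalizedModule.map_injective _ _ _ g h

theorem lmap_surj (f : S) (g : X →ₗ[S] Y) (h : Function.Surjective g) :
    Function.Surjective (lmap f g) :=
  IsLocalizedModule.map_surjective _ _ _ g h

theorem lmap_exact (f : S) (g : X →ₗ[S] Y) (h : Y →ₗ[S] Z) (H : Function.Exact g h) :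
    Function.Exact (lmap f g) (lmap f h) :=
  IsLocalizedModule.map_exact _ _ _ _ g h H

theorem Loc.subsingleton (f : S) (h : ∀ x : X, f • x = 0) : Subsingleton (Loc f X) := by
  refine ⟨fun a b => ?_⟩
  have key : ∀ a : Loc f X, a = 0 := by
    intro a
    obtain ⟨k, x, hx⟩ := Loc.exists_pow f a
    apply Loc.pow_inj f k
    rw [hx, smul_zero, lι_eq_zero]
    exact ⟨1, by simpa using h x⟩
  rw [key a, key b]

end Loc

/-- Cochain complexes, concretely. -/
structure Cx (S : Type u) [CommRing S] where
  X : ℕ → ModuleCat.{u} S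
  d : ∀ i, X i →ₗ[S] X (i + 1)
  dd : ∀ i x, d (i + 1) (d i x) = 0

namespace Cx
variable {S : Type u} [CommRing S]

@[ext] structure Hom (C D : Cx S) where
  f : ∀ i, C.X i →ₗ[S] D.X i
  comm : ∀ i x, f (i + 1) (C.d i x) = D.d i (f i x)

noncomputable def stepX (f : S) (C : Cx S) : ℕ → ModuleCat.{u} S
  | 0 => C.X 0
  | i + 1 => ModuleCat.of S (C.X (i + 1) × Loc f (C.X i))

noncomputable def stepd (f : S) (C : Cx S) : ∀ i, stepX f C i →ₗ[S] stepX f C (i + 1)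
  | 0 => LinearMap.prod (C.d 0) (lι f (C.X 0))
  | i + 1 => LinearMap.prod (C.d (i + 1) ∘ₗ LinearMap.fst S (C.X (i + 1)) (Loc f (C.X i)))
      (lι f (C.X (i + 1)) ∘ₗ LinearMap.fst S (C.X (i + 1)) (Loc f (C.X i)) -
        lmap f (C.d i) ∘ₗ LinearMap.snd S (C.X (i + 1)) (Loc f (C.X i)))

/-- fibre of `C → C_f` -/
noncomputable def step (f : S) (C : Cx S) : Cx S where
  X := stepX f C
  d := stepd f C
  dd := by
    have key : ∀ i (y : Loc f (C.X i)), lmap f (C.d (i + 1)) (lmap f (C.d i) y) = 0 := by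
      intro i y
      have h0 : C.d (i + 1) ∘ₗ C.d i = 0 := LinearMap.ext (C.dd i)
      rw [← LinearMap.comp_apply, ← lmap_comp, h0, lmap_zero]; rfl
    rintro (_ | i) x
    · refine Prod.ext (C.dd 0 x) ?_
      change lι f _ (C.d 0 x) - lmap f (C.d 0) (lι f _ x) = 0
      exact sub_eq_zero.2 (lmap_lι f (C.d 0) x).symm
    · obtain ⟨x, y⟩ := x
      refine Prod.ext (C.dd (i + 1) x) ?_
      change lι f _ (C.d (i + 1) x) - lmap f (C.d (i + 1)) (lι f _ x - lmap f (C.d i) y) = 0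
      rw [map_sub, lmap_lι, key, sub_zero, sub_self]

theorem step_d_succ (f : S) (C : Cx S) (i : ℕ) (x : C.X (i + 1)) (y : Loc f (C.X i)) :
    (step f C).d (i + 1) (x, y) = (C.d (i + 1) x, lι f _ x - lmap f (C.d i) y) := rfl

theorem step_d_zero (f : S) (C : Cx S) (x : C.X 0) :
    (step f C).d 0 x = (C.d 0 x, lι f _ x) := rfl

noncomputable def stepHom (f : S) {C D : Cx S} (φ : Hom C D) : Hom (step f C) (step f D) where
  f := fun i => match i with
    | 0 => φ.f 0
    | i + 1 => LinearMap.prodMap (φ.f (i + 1)) (lmap f (φ.f i))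
  comm := by
    rintro (_ | i) x
    · refine Prod.ext (φ.comm 0 x) ?_
      change lmap f (φ.f 0) (lι f _ x) = lι f _ (φ.f 0 x)
      exact lmap_lι f (φ.f 0) x
    · obtain ⟨x, y⟩ := x
      refine Prod.ext (φ.comm (i + 1) x) ?_
      change lmap f (φ.f (i + 1)) (lι f _ x - lmap f (C.d i) y) =
        lι f _ (φ.f (i + 1) x) - lmap f (D.d i) (lmap f (φ.f i) y)
      rw [map_sub, lmap_lι]
      congr 1
      rw [← LinearMap.comp_apply, ← LinearMap.comp_apply, ← lmap_comp, ← lmap_comp]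
      congr 1
      congr 1
      exact LinearMap.ext (φ.comm i)

theorem stepHom_succ (f : S) {C D : Cx S} (φ : Hom C D) (i : ℕ) (x : C.X (i + 1))
    (y : Loc f (C.X i)) :
    (stepHom f φ).f (i + 1) (x, y) = (φ.f (i + 1) x, lmap f (φ.f i) y) := rfl

/-- `M` in degree one. -/
noncomputable def baseX (M : Type u) [AddCommGroup M] [Module S M] : ℕ → ModuleCat.{u} S
  | 1 => ModuleCat.of S M
  | _ => ModuleCat.of S PUnit.{u+1}

noncomputable def base (M : Type u) [AddCommGroup M] [Module S M] : Cx S where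
  X := baseX M
  d := fun _ => 0
  dd := fun _ _ => rfl

noncomputable def baseHom {M N : Type u} [AddCommGroup M] [Module S M] [AddCommGroup N]
    [Module S N] (g : M →ₗ[S] N) : Hom (base M : Cx S) (base N) where
  f := fun i => match i with
    | 0 => 0
    | 1 => g
    | _ + 2 => 0
  comm := by
    intro i x
    change _ = (0 : _)
    exact map_zero _

noncomputable def K (M : Type u) [AddCommGroup M] [Module S M] : List S → Cx S
  | [] => base M
  | f :: fs => step f (K M fs)

noncomputable def KHom {M N : Type u} [AddCommGroup M] [Module S M] [AddCommGroup N]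
    [Module S N] (g : M →ₗ[S] N) : ∀ fs : List S, Hom (K M fs) (K N fs)
  | [] => baseHom g
  | f :: fs => stepHom f (KHom g fs)

section props
variable {M N P : Type u} [AddCommGroup M] [Module S M] [AddCommGroup N]
    [Module S N] [AddCommGroup P] [Module S P]

theorem KHom_comp (g : M →ₗ[S] N) (h : N →ₗ[S] P) (fs : List S) (i : ℕ) :
    (KHom (h ∘ₗ g) fs).f i = (KHom h fs).f i ∘ₗ (KHom g fs).f i := by
  induction fs generalizing i with
  | nil =>
    match i with
    | 0 => rfl
    | 1 => rfl
    | _ + 2 => rfl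
  | cons f fs ih =>
    match i with
    | 0 => exact ih 0
    | i + 1 =>
      change LinearMap.prodMap _ (lmap f _) = LinearMap.prodMap _ (lmap f _) ∘ₗ
        LinearMap.prodMap _ (lmap f _)
      rw [ih, ih, lmap_comp, LinearMap.prodMap_comp]

theorem KHom_smul (s : S) (fs : List S) (i : ℕ) :
    (KHom (s • (LinearMap.id : M →ₗ[S] M)) fs).f i = s • LinearMap.id := by
  induction fs generalizing i with
  | nil =>
    match i with
    | 0 => rfl
    | 1 => rfl
    | _ + 2 => rfl
  | cons f fs ih =>
    match i with
    | 0 => exact ih 0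
    | i + 1 =>
      change LinearMap.prodMap _ (lmap f _) = _
      rw [ih, ih, lmap_smul_id]
      rfl

theorem KHom_inj (g : M →ₗ[S] N) (hg : Function.Injective g) (fs : List S) (i : ℕ) :
    Function.Injective ((KHom g fs).f i) := by
  induction fs generalizing i with
  | nil =>
    match i with
    | 0 => exact fun _ _ _ => rfl
    | 1 => exact hg
    | _ + 2 => exact fun _ _ _ => rfl
  | cons f fs ih =>
    match i with
    | 0 => exact ih 0
    | i + 1 => exact (ih (i + 1)).prodMap (lmap_inj f _ (ih i))

theorem KHom_surj (g : M →ₗ[S] N) (hg : Function.Surjective g) (fs : List S) (i : ℕ) :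
    Function.Surjective ((KHom g fs).f i) := by
  induction fs generalizing i with
  | nil =>
    match i with
    | 0 => exact fun _ => ⟨PUnit.unit, rfl⟩
    | 1 => exact hg
    | _ + 2 => exact fun _ => ⟨PUnit.unit, rfl⟩
  | cons f fs ih =>
    match i with
    | 0 => exact ih 0
    | i + 1 => exact (ih (i + 1)).prodMap (lmap_surj f _ (ih i))

theorem KHom_exact (g : M →ₗ[S] N) (h : N →ₗ[S] P) (H : Function.Exact g h)
    (fs : List S) (i : ℕ) :
    Function.Exact ((KHom g fs).f i) ((KHom h fs).f i) := by
  induction fs generalizing i with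
  | nil =>
    match i with
    | 0 => exact fun x => ⟨fun _ => ⟨PUnit.unit, rfl⟩, fun _ => rfl⟩
    | 1 => exact H
    | _ + 2 => exact fun x => ⟨fun _ => ⟨PUnit.unit, rfl⟩, fun _ => rfl⟩
  | cons f fs ih =>
    match i with
    | 0 => exact ih 0
    | i + 1 =>
      have h1 := ih (i + 1)
      have h2 := lmap_exact f _ _ (ih i)
      rintro ⟨x, y⟩
      constructor
      · intro hxy
        obtain ⟨a, ha⟩ := (h1 x).1 (congrArg Prod.fst hxy)
        obtain ⟨b, hb⟩ := (h2 y).1 (congrArg Prod.snd hxy)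
        exact ⟨(a, b), Prod.ext ha hb⟩
      · rintro ⟨⟨a, b⟩, hab⟩
        exact Prod.ext ((h1 x).2 ⟨a, congrArg Prod.fst hab⟩) ((h2 y).2 ⟨b, congrArg Prod.snd hab⟩)

theorem K_zero (fs : List S) : Subsingleton ((K M fs).X 0) := by
  induction fs with
  | nil => exact ⟨fun _ _ => rfl⟩
  | cons f fs ih => exact ih

/-- degree one is `M` -/
noncomputable def Ke (M : Type u) [AddCommGroup M] [Module S M] :
    ∀ fs : List S, (K M fs).X 1 ≃ₗ[S] M
  | [] => LinearEquiv.refl S M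
  | f :: fs =>
    { toFun := fun x => Ke M fs x.1
      map_add' := fun x y => map_add (Ke M fs) x.1 y.1
      map_smul' := fun r x => (Ke M fs).map_smul r x.1
      invFun := fun m => ((Ke M fs).symm m, 0)
      left_inv := by
        rintro ⟨x, y⟩
        have h0 : Subsingleton ((K M fs).X 0) := K_zero fs
        have h1 : Subsingleton (Loc f ((K M fs).X 0)) :=
          Loc.subsingleton f (fun x => Subsingleton.elim _ _)
        exact Prod.ext ((Ke M fs).symm_apply_apply x) (Subsingleton.elim _ _)
      right_inv := fun m => (Ke M fs).apply_symm_apply m }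

theorem Ke_nat (g : M →ₗ[S] N) (fs : List S) (x : (K M fs).X 1) :
    Ke N fs ((KHom g fs).f 1 x) = g (Ke M fs x) := by
  induction fs with
  | nil => rfl
  | cons f fs ih => exact ih x.1

theorem K_one (M : Type u) [AddCommGroup M] [Module S M] (fs : List S) :
    ∀ x, (K M fs).d 1 x = 0 ↔ ∀ f ∈ fs, ∃ m : ℕ, f ^ m • Ke M fs x = 0 := by
  induction fs with
  | nil =>
    intro x
    simp only [List.not_mem_nil, false_imp_iff, implies_true, iff_true]
    rfl
  | cons f fs he =>
    have h0 : Subsingleton ((K M fs).X 0) := K_zero fs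
    have h1 : Subsingleton (Loc f ((K M fs).X 0)) :=
      Loc.subsingleton f (fun x => Subsingleton.elim _ _)
    rintro ⟨x, y⟩
    have hy : y = 0 := Subsingleton.elim _ _
    subst hy
    have : (K M (f :: fs)).d 1 (x, 0) = ((K M fs).d 1 x, lι f _ x - lmap f ((K M fs).d 0) 0) := rfl
    rw [this, map_zero, sub_zero]
    refine Iff.trans (show _ ↔ ((K M fs).d 1 x = 0 ∧ lι f _ x = 0) from
      ⟨fun h => ⟨congrArg Prod.fst h, congrArg Prod.snd h⟩, fun h => Prod.ext h.1 h.2⟩) ?_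
    change ((K M fs).d 1 x = 0 ∧ lι f _ x = 0) ↔ ∀ g ∈ f :: fs, ∃ m : ℕ, g ^ m • Ke M fs x = 0
    rw [he, lι_eq_zero, List.forall_mem_cons, and_comm]
    have : ∀ m : ℕ, f ^ m • x = 0 ↔ f ^ m • Ke M fs x = 0 := by
      intro m
      rw [← map_smul, LinearEquiv.map_eq_zero_iff]
    simp only [this]

theorem K_van (fs : List S) (h : ∀ f ∈ fs, ∀ m : M, f • m = 0) (i : ℕ) :
    Subsingleton ((K M fs).X (i + 2)) := by
  induction fs generalizing i with
  | nil => exact ⟨fun _ _ => rfl⟩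
  | cons f fs ih =>
    have h' := fun g hg => h g (List.mem_cons_of_mem f hg)
    have h1 := ih h' i
    have h2 : Subsingleton (Loc f ((K M fs).X (i + 1))) := by
      match i with
      | 0 =>
        refine Loc.subsingleton f (fun x => (Ke M fs).injective ?_)
        rw [map_smul, map_zero]
        exact h f List.mem_cons_self _
      | i + 1 =>
        have := ih h' i
        exact Loc.subsingleton f (fun x => Subsingleton.elim _ _)
    exact inferInstanceAs (Subsingleton ((K M fs).X (i + 2) × Loc f ((K M fs).X (i + 1))))

end props
end Cx


set_option linter.unusedSectionVars false

namespace Cx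
variable {S : Type u} [CommRing S]

/-- cohomology in degree `i + 1` of the complex -/
noncomputable def H (C : Cx S) (i : ℕ) : ModuleCat.{u} S :=
  ModuleCat.of S (LinearMap.ker (C.d (i + 1)) ⧸
    (LinearMap.range (C.d i)).submoduleOf (LinearMap.ker (C.d (i + 1))))

noncomputable def hproj (C : Cx S) (i : ℕ) : LinearMap.ker (C.d (i + 1)) →ₗ[S] H C i :=
  Submodule.mkQ _

theorem hproj_surj (C : Cx S) (i : ℕ) : Function.Surjective (hproj C i) :=
  Submodule.mkQ_surjective _

theorem hproj_eq_zero (C : Cx S) (i : ℕ) (x : LinearMap.ker (C.d (i + 1))) :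
    hproj C i x = 0 ↔ ∃ w, C.d i w = x := by
  change Submodule.Quotient.mk x = 0 ↔ _
  rw [Submodule.Quotient.mk_eq_zero]
  rfl

theorem H_sub (C : Cx S) (i : ℕ)
    (h : ∀ x, C.d (i + 1) x = 0 → ∃ w, C.d i w = x) : Subsingleton (H C i) := by
  have key : ∀ a : H C i, a = 0 := by
    intro a
    obtain ⟨x, rfl⟩ := hproj_surj C i a
    exact (hproj_eq_zero C i x).2 (h x x.2)
  exact ⟨fun a b => by rw [key a, key b]⟩

theorem exact_of_H_sub (C : Cx S) (i : ℕ) (h : Subsingleton (H C i)) (x : C.X (i + 1))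
    (hx : C.d (i + 1) x = 0) : ∃ w, C.d i w = x :=
  (hproj_eq_zero C i ⟨x, hx⟩).1 (Subsingleton.elim _ _)

noncomputable def zmap {C D : Cx S} (φ : Hom C D) (i : ℕ) :
    LinearMap.ker (C.d i) →ₗ[S] LinearMap.ker (D.d i) :=
  (φ.f i).restrict (fun x (hx : C.d i x = 0) => show D.d i (φ.f i x) = 0 by
    rw [← φ.comm, hx, map_zero])

theorem zmap_coe {C D : Cx S} (φ : Hom C D) (i : ℕ) (x : LinearMap.ker (C.d i)) :
    (zmap φ i x : D.X i) = φ.f i x := rfl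

noncomputable def hmap {C D : Cx S} (φ : Hom C D) (i : ℕ) : H C i →ₗ[S] H D i :=
  Submodule.mapQ _ _ (zmap φ (i + 1)) (by
    rintro x ⟨w, hw⟩
    refine ⟨φ.f i w, ?_⟩
    rw [← φ.comm, hw]
    rfl)

theorem hmap_hproj {C D : Cx S} (φ : Hom C D) (i : ℕ) (x : LinearMap.ker (C.d (i + 1))) :
    hmap φ i (hproj C i x) = hproj D i (zmap φ (i + 1) x) := rfl

theorem H_hom_ext {C : Cx S} {i : ℕ} {Y : Type u} [AddCommGroup Y] [Module S Y]
    {g h : H C i →ₗ[S] Y} (e : ∀ x, g (hproj C i x) = h (hproj C i x)) : g = h := by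
  ext a
  obtain ⟨x, rfl⟩ := hproj_surj C i a
  exact e x

section les
variable {A B C : Cx S} (φ : Hom A B) (ψ : Hom B C)
  (hφ : ∀ i, Function.Injective (φ.f i)) (hψ : ∀ i, Function.Surjective (ψ.f i))
  (hex : ∀ i, Function.Exact (φ.f i) (ψ.f i))

theorem les_mid (hφ : ∀ i, Function.Injective (φ.f i)) (hψ : ∀ i, Function.Surjective (ψ.f i))
    (hex : ∀ i, Function.Exact (φ.f i) (ψ.f i)) (i : ℕ) :
    Function.Exact (hmap φ i) (hmap ψ i) := by
  intro a
  constructor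
  · obtain ⟨⟨x, hx⟩, rfl⟩ := hproj_surj B i a
    intro h
    rw [hmap_hproj, hproj_eq_zero] at h
    obtain ⟨w, hw⟩ := h
    obtain ⟨v, rfl⟩ := hψ i w
    rw [← ψ.comm, zmap_coe] at hw
    have h1 : ψ.f (i + 1) (x - B.d i v) = 0 := by rw [map_sub, hw, sub_self]
    obtain ⟨y, hy⟩ := (hex (i + 1) _).1 h1
    have hy0 : A.d (i + 1) y = 0 := by
      apply hφ (i + 2)
      rw [φ.comm, hy, map_sub, B.dd, show B.d (i + 1) x = 0 from hx, sub_zero, map_zero]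
    refine ⟨hproj A i ⟨y, hy0⟩, ?_⟩
    rw [hmap_hproj, ← sub_eq_zero, ← map_sub, hproj_eq_zero]
    refine ⟨-v, ?_⟩
    change _ = φ.f (i + 1) y - x
    rw [hy, map_neg]
    abel
  · rintro ⟨a', rfl⟩
    obtain ⟨x, rfl⟩ := hproj_surj A i a'
    rw [hmap_hproj, hmap_hproj, hproj_eq_zero]
    refine ⟨0, ?_⟩
    rw [map_zero]
    exact ((hex (i + 1) _).2 ⟨_, rfl⟩).symm

theorem les_del (hφ : ∀ i, Function.Injective (φ.f i)) (hψ : ∀ i, Function.Surjective (ψ.f i))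
    (hex : ∀ i, Function.Exact (φ.f i) (ψ.f i)) (i : ℕ) :
    ∃ δ : H C i →ₗ[S] H A (i + 1), Function.Exact (hmap ψ i) δ ∧
      Function.Exact δ (hmap φ (i + 1)) := by
  let Z : Submodule S (B.X (i + 1)) := LinearMap.ker (C.d (i + 1) ∘ₗ ψ.f (i + 1))
  let p : Z →ₗ[S] H C i := hproj C i ∘ₗ
    (LinearMap.codRestrict _ (ψ.f (i + 1) ∘ₗ Z.subtype) (fun z => z.2))
  have hp : Function.Surjective p := by
    intro a
    obtain ⟨⟨x, hx⟩, rfl⟩ := hproj_surj C i a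
    obtain ⟨y, rfl⟩ := hψ (i + 1) x
    exact ⟨⟨y, hx⟩, rfl⟩
  have hZ : ∀ z : Z, ∃ y : LinearMap.ker (A.d (i + 2)), φ.f (i + 2) y = B.d (i + 1) z := by
    intro z
    obtain ⟨y, hy⟩ := (hex (i + 2) (B.d (i + 1) z)).1 (by rw [ψ.comm]; exact z.2)
    refine ⟨⟨y, ?_⟩, hy⟩
    apply hφ (i + 3)
    rw [φ.comm, hy, B.dd, map_zero]
  choose q hq using hZ
  let q' : Z →ₗ[S] LinearMap.ker (A.d (i + 2)) :=
    { toFun := q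
      map_add' := by
        intro a b
        apply Subtype.ext
        apply hφ (i + 2)
        rw [hq]
        change _ = φ.f (i + 2) (q a + q b : A.X (i + 2))
        rw [map_add, hq, hq]
        exact map_add _ _ _
      map_smul' := by
        intro r a
        apply Subtype.ext
        apply hφ (i + 2)
        rw [hq]
        change _ = φ.f (i + 2) (r • (q a : A.X (i + 2)))
        rw [map_smul, hq]
        exact map_smul _ _ _ }
  have hpz : ∀ z : Z, p z = 0 → ∃ (w : B.X i) (a : A.X (i + 1)), (z : B.X (i + 1)) =
      B.d i w + φ.f (i + 1) a := by
    intro z hz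
    obtain ⟨w, hw⟩ := (hproj_eq_zero C i _).1 hz
    obtain ⟨v, rfl⟩ := hψ i w
    rw [← ψ.comm] at hw
    obtain ⟨a, ha⟩ := (hex (i + 1) (z - B.d i v)).1 (by rw [map_sub, hw]; exact sub_self _)
    exact ⟨v, a, by rw [ha]; abel⟩
  have hker : LinearMap.ker p ≤ LinearMap.ker (hproj A (i + 1) ∘ₗ q') := by
    intro z hz
    obtain ⟨w, a, hwa⟩ := hpz z hz
    change hproj A (i + 1) (q z) = 0
    rw [hproj_eq_zero]
    refine ⟨a, ?_⟩
    apply hφ (i + 2)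
    rw [hq, φ.comm, hwa, map_add, B.dd, zero_add]
  let δ : H C i →ₗ[S] H A (i + 1) :=
    (LinearMap.ker p).liftQ (hproj A (i + 1) ∘ₗ q') hker ∘ₗ
      (p.quotKerEquivOfSurjective hp).symm.toLinearMap
  have hδ : ∀ z, δ (p z) = hproj A (i + 1) (q z) := by
    intro z
    have : (p.quotKerEquivOfSurjective hp).symm (p z) = Submodule.Quotient.mk z := by
      rw [LinearEquiv.symm_apply_eq]; rfl
    change (LinearMap.ker p).liftQ _ hker ((p.quotKerEquivOfSurjective hp).symm (p z)) = _
    rw [this]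
    rfl
  refine ⟨δ, fun c => ⟨?_, ?_⟩, fun a => ⟨?_, ?_⟩⟩
  · obtain ⟨z, rfl⟩ := hp c
    intro h
    rw [hδ, hproj_eq_zero] at h
    obtain ⟨a, ha⟩ := h
    have h0 : B.d (i + 1) (z - φ.f (i + 1) a) = 0 := by
      rw [map_sub, ← hq, ← ha, φ.comm, sub_self]
    refine ⟨hproj B i ⟨_, h0⟩, ?_⟩
    rw [hmap_hproj]
    refine congrArg (hproj C i) (Subtype.ext ?_)
    change ψ.f (i + 1) (z - φ.f (i + 1) a) = ψ.f (i + 1) z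
    rw [map_sub, (hex (i + 1) _).2 ⟨a, rfl⟩, sub_zero]
  · rintro ⟨b, rfl⟩
    obtain ⟨⟨x, hx⟩, rfl⟩ := hproj_surj B i b
    have hxZ : x ∈ Z := by
      change C.d (i + 1) (ψ.f (i + 1) x) = 0
      rw [← ψ.comm, show B.d (i + 1) x = 0 from hx, map_zero]
    change δ (p ⟨x, hxZ⟩) = 0
    rw [hδ, hproj_eq_zero]
    refine ⟨0, ?_⟩
    apply hφ (i + 2)
    rw [hq, map_zero, map_zero]
    exact (show B.d (i + 1) x = 0 from hx).symm
  · obtain ⟨⟨x, hx⟩, rfl⟩ := hproj_surj A (i + 1) a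
    rw [hmap_hproj, hproj_eq_zero]
    rintro ⟨w, hw⟩
    have hwZ : w ∈ Z := by
      change C.d (i + 1) (ψ.f (i + 1) w) = 0
      rw [← ψ.comm, hw]
      exact (hex (i + 2) _).2 ⟨x, rfl⟩
    refine ⟨p ⟨w, hwZ⟩, ?_⟩
    rw [hδ]
    congr 1
    apply Subtype.ext
    apply hφ (i + 2)
    rw [hq]
    exact hw
  · rintro ⟨c, rfl⟩
    obtain ⟨z, rfl⟩ := hp c
    rw [hδ, hmap_hproj, hproj_eq_zero]
    exact ⟨z, (hq z).symm⟩

end les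

theorem step_tors (C : Cx S) (h0 : Subsingleton (C.X 0)) (f : S) (i : ℕ) (x : H (step f C) i) :
    ∃ k : ℕ, f ^ k • x = 0 := by
  obtain ⟨⟨⟨x, y⟩, hx⟩, rfl⟩ := hproj_surj _ i x
  have hx1 : C.d (i + 1) x = 0 := congrArg Prod.fst hx
  have hx2 : lι f _ x - lmap f (C.d i) y = 0 := congrArg Prod.snd hx
  obtain ⟨k, y0, hy0⟩ := Loc.exists_pow f y
  have h1 : lι f _ (f ^ k • x - C.d i y0) = 0 := by
    rw [map_sub, map_smul, ← lmap_lι, ← hy0, map_smul, ← smul_sub, hx2, smul_zero]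
  obtain ⟨m, hm⟩ := (lι_eq_zero f _).1 h1
  refine ⟨m + k, ?_⟩
  rw [← map_smul, hproj_eq_zero]
  have e1 : f ^ (m + k) • x = C.d i (f ^ m • y0) := by
    rw [pow_add, mul_smul, map_smul, ← sub_eq_zero, ← smul_sub, hm]
  have e2 : f ^ (m + k) • y = lι f _ (f ^ m • y0) := by
    rw [pow_add, mul_smul, hy0, map_smul]
  match i with
  | 0 => exact ⟨f ^ m • y0, Prod.ext e1.symm e2.symm⟩
  | i + 1 =>
    refine ⟨(f ^ m • y0, 0), Prod.ext e1.symm ?_⟩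
    change lι f _ (f ^ m • y0) - lmap f (C.d i) 0 = f ^ (m + k) • y
    rw [map_zero, sub_zero, e2]

theorem step_tors' (C : Cx S) (f g : S) (i : ℕ)
    (H1 : ∀ i (x : H C i), ∃ k : ℕ, g ^ k • x = 0) (h0 : Subsingleton (C.X 0))
    (x : H (step f C) i) :
    ∃ k : ℕ, g ^ k • x = 0 := by
  obtain ⟨⟨⟨x, y⟩, hx⟩, rfl⟩ := hproj_surj _ i x
  have hx1 : C.d (i + 1) x = 0 := congrArg Prod.fst hx
  have hx2 : lι f _ x - lmap f (C.d i) y = 0 := congrArg Prod.snd hx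
  obtain ⟨k, hk⟩ := H1 i (hproj C i ⟨x, hx1⟩)
  rw [← map_smul, hproj_eq_zero] at hk
  obtain ⟨w, hw⟩ := hk
  change C.d i w = g ^ k • x at hw
  -- subtract the boundary of `w`
  have h2 : lmap f (C.d i) (g ^ k • y - lι f _ w) = 0 := by
    rw [map_sub, lmap_lι, hw, map_smul, map_smul, ← smul_sub,
      show lmap f (C.d i) y - lι f _ x = 0 by rw [← neg_sub, hx2, neg_zero], smul_zero]
  match i with
  | 0 =>
    refine ⟨k, ?_⟩
    rw [← map_smul, hproj_eq_zero]
    have : Subsingleton (Loc f (C.X 0)) := Loc.subsingleton f (fun x => Subsingleton.elim _ _)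
    exact ⟨w, Prod.ext hw (Subsingleton.elim (α := Loc f (C.X 0)) _ _)⟩
  | i + 1 =>
    obtain ⟨l, y0, hy0⟩ := Loc.exists_pow f (g ^ k • y - lι f _ w)
    have h3 : lι f _ (C.d (i + 1) y0) = 0 := by
      rw [← lmap_lι, ← hy0, map_smul, h2, smul_zero]
    obtain ⟨m, hm⟩ := (lι_eq_zero f _).1 h3
    rw [← map_smul] at hm
    obtain ⟨j, hj⟩ := H1 i (hproj C i ⟨f ^ m • y0, hm⟩)
    rw [← map_smul, hproj_eq_zero] at hj
    obtain ⟨v, hv⟩ := hj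
    change C.d i v = g ^ j • f ^ m • y0 at hv
    obtain ⟨v', hv'⟩ := Loc.pow_surj f (m + l) (lι f _ v)
    refine ⟨j + k, ?_⟩
    rw [← map_smul, hproj_eq_zero]
    refine ⟨(g ^ j • w, - v'), Prod.ext ?_ ?_⟩
    · change C.d (i + 1) (g ^ j • w) = g ^ (j + k) • x
      rw [map_smul, hw, pow_add, mul_smul]
    · change lι f _ (g ^ j • w) - lmap f (C.d i) (- v') = g ^ (j + k) • y
      apply Loc.pow_inj f (m + l)
      rw [map_neg, sub_neg_eq_add, smul_add, ← map_smul (lmap f (C.d i)), hv', lmap_lι, hv,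
        map_smul, map_smul, map_smul, ← hy0, pow_add g, mul_smul]
      rw [pow_add f]
      simp only [smul_sub, smul_smul]
      rw [← add_sub_assoc, add_sub_right_comm]
      have e1 : f ^ m * f ^ l * g ^ j = g ^ j * f ^ m * f ^ l := by ring
      simp only [← mul_assoc] at *
      rw [e1, sub_self, zero_add]

theorem K_tors (M : Type u) [AddCommGroup M] [Module S M] (fs : List S) :
    ∀ f ∈ fs, ∀ i (x : H (K M fs) i), ∃ k : ℕ, f ^ k • x = 0 := by
  induction fs with
  | nil => intro f hf; simp at hf
  | cons f fs ih =>
    intro g hg i x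
    rcases List.mem_cons.1 hg with rfl | hg
    · exact step_tors (K M fs) (K_zero fs) g i x
    · exact step_tors' (K M fs) f g i (ih g hg) (K_zero fs) x

/-- augmentation -/
noncomputable def hε (M : Type u) [AddCommGroup M] [Module S M] (fs : List S) :
    H (K M fs) 0 →ₗ[S] M :=
  Submodule.liftQ _ ((Ke M fs).toLinearMap ∘ₗ (LinearMap.ker ((K M fs).d 1)).subtype) (by
    have : Subsingleton ((K M fs).X 0) := K_zero fs
    rintro x ⟨w, hw⟩
    rw [Subsingleton.elim w 0, map_zero] at hw
    change Ke M fs x = 0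
    rw [show (x : (K M fs).X 1) = 0 from hw.symm, map_zero])

theorem hε_hproj (M : Type u) [AddCommGroup M] [Module S M] (fs : List S)
    (x : LinearMap.ker ((K M fs).d 1)) : hε M fs (hproj _ 0 x) = Ke M fs x := rfl

theorem hε_inj (M : Type u) [AddCommGroup M] [Module S M] (fs : List S) :
    Function.Injective (hε M fs) := by
  rw [injective_iff_map_eq_zero]
  intro a ha
  obtain ⟨x, rfl⟩ := hproj_surj _ _ a
  rw [hproj_eq_zero]
  refine ⟨0, ?_⟩
  rw [map_zero]
  exact ((Ke M fs).map_eq_zero_iff.1 ha).symm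

theorem hε_nat {M N : Type u} [AddCommGroup M] [Module S M] [AddCommGroup N] [Module S N]
    (g : M →ₗ[S] N) (fs : List S) (x) :
    hε N fs (hmap (KHom g fs) 0 x) = g (hε M fs x) := by
  obtain ⟨x, rfl⟩ := hproj_surj _ _ x
  rw [hmap_hproj]
  exact Ke_nat g fs x

theorem hε_range (M : Type u) [AddCommGroup M] [Module S M] (fs : List S) (m : M) :
    m ∈ LinearMap.range (hε M fs) ↔ ∀ f ∈ fs, ∃ k : ℕ, f ^ k • m = 0 := by
  constructor
  · rintro ⟨x, rfl⟩
    obtain ⟨x, rfl⟩ := hproj_surj _ _ x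
    exact (K_one M fs x).1 x.2
  · intro h
    refine ⟨hproj _ 0 ⟨(Ke M fs).symm m, (K_one M fs _).2 ?_⟩, ?_⟩
    · simpa using h
    · exact (Ke M fs).apply_symm_apply m

/-- The Cech local cohomology theory. -/
noncomputable def cech (fs : List S) : LCT S (Ideal.span {f | f ∈ fs}) where
  obj := fun i M _ _ => H (K M fs) i
  map := fun i _ _ _ _ _ _ g => hmap (KHom g fs) i
  map_comp := by
    intro i M N P _ _ _ _ _ _ f g
    refine H_hom_ext (fun x => ?_)
    rw [LinearMap.comp_apply, hmap_hproj, hmap_hproj, hmap_hproj]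
    congr 1
    apply Subtype.ext
    rw [zmap_coe, KHom_comp]
    rfl
  map_smul := by
    intro i M _ _ s
    refine H_hom_ext (fun x => ?_)
    rw [hmap_hproj]
    change _ = s • hproj (K M fs) i x
    rw [← map_smul]
    congr 1
    apply Subtype.ext
    rw [zmap_coe, KHom_smul]
    rfl
  exact_mid := by
    intro i M N P _ _ _ _ _ _ f g hf hg hfg
    exact les_mid _ _ (KHom_inj f hf fs) (KHom_surj g hg fs) (KHom_exact f g hfg fs) i
  exact_del := by
    intro i M N P _ _ _ _ _ _ f g hf hg hfg
    exact les_del _ _ (KHom_inj f hf fs) (KHom_surj g hg fs) (KHom_exact f g hfg fs) i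
  inj_zero := by
    intro M N _ _ _ _ f hf
    rw [injective_iff_map_eq_zero]
    intro a ha
    obtain ⟨x, rfl⟩ := hproj_surj _ _ a
    rw [hmap_hproj, hproj_eq_zero] at ha
    obtain ⟨w, hw⟩ := ha
    have : Subsingleton ((K N fs).X 0) := K_zero fs
    rw [Subsingleton.elim w 0, map_zero, zmap_coe] at hw
    have hx0 : (x : (K M fs).X 1) = 0 :=
      KHom_inj f hf fs 1 (by rw [map_zero]; exact hw.symm)
    rw [hproj_eq_zero]
    exact ⟨0, by rw [map_zero, hx0]⟩
  tors := by
    intro i M _ _ x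
    have h1 : Ideal.span {f | f ∈ fs} ≤ (Ideal.torsionOf S _ x).radical := by
      rw [Ideal.span_le]
      intro f hf
      obtain ⟨k, hk⟩ := K_tors M fs f hf i x
      exact ⟨k, (Ideal.mem_torsionOf_iff _ _).2 hk⟩
    have hfg : (Ideal.span {f | f ∈ fs}).FG :=
      Submodule.fg_span (List.finite_toSet fs)
    obtain ⟨n, hn⟩ := Ideal.exists_pow_le_of_le_radical_of_fg h1 hfg
    exact ⟨n, fun r hr => (Ideal.mem_torsionOf_iff _ _).1 (hn hr)⟩
  van := by
    intro i M _ _ h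
    have := K_van (M := M) fs (fun f hf m => h f (Ideal.subset_span hf) m) i
    exact H_sub _ _ (fun x _ => ⟨0, Subsingleton.elim _ _⟩)
  emb := by
    intro M _ _
    exact ⟨hε M fs, hε_inj M fs⟩

end Cx


set_option linter.unusedSectionVars false

section
variable {S : Type u} [CommRing S]

theorem inj_factor {E A B : Type u} [AddCommGroup E] [Module S E] [AddCommGroup A] [Module S A]
    [AddCommGroup B] [Module S B] [Module.Injective S E] (α : A →ₗ[S] B) (β : A →ₗ[S] E)
    (h : ∀ a, α a = 0 → β a = 0) : ∃ φ : B →ₗ[S] E, ∀ a, φ (α a) = β a := by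
  obtain ⟨φ, hφ⟩ := Module.Injective.out (Q := E) ((LinearMap.ker α).liftQ α le_rfl)
    (LinearMap.ker_eq_bot.1 (Submodule.ker_liftQ_eq_bot _ _ _ le_rfl))
    ((LinearMap.ker α).liftQ β h)
  exact ⟨φ, fun a => hφ (Submodule.Quotient.mk a)⟩

theorem inj_div [IsNoetherianRing S] {E : Type u} [AddCommGroup E] [Module S E]
    [Module.Injective S E] (b : Ideal S) (f : S) (x : E) (c k : ℕ)
    (hx : ∀ r ∈ b ^ c, r • x = 0) :
    ∃ (y : E) (a N : ℕ), (∀ r ∈ b ^ N, r • y = 0) ∧ f ^ (a + k) • y = f ^ a • x := by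
  obtain ⟨a, ha⟩ := (monotone_stabilizes_iff_noetherian (R := S) (M := S)).2 inferInstance
    { toFun := fun n => LinearMap.ker (f ^ n • (LinearMap.id : S →ₗ[S] S))
      monotone' := by
        intro m n hmn r hr
        change f ^ n * r = 0
        have hr' : f ^ m * r = 0 := hr
        obtain ⟨l, rfl⟩ := Nat.exists_eq_add_of_le hmn
        rw [pow_add, mul_comm (f ^ m), mul_assoc, hr', mul_zero] }
  have ha' : ∀ r : S, f ^ (a + k) * r = 0 → f ^ a * r = 0 := by
    intro r hr
    have h1 := ha (a + k) (Nat.le_add_right a k)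
    have h2 : r ∈ LinearMap.ker (f ^ (a + k) • (LinearMap.id : S →ₗ[S] S)) := hr
    have h3 : r ∈ LinearMap.ker (f ^ a • (LinearMap.id : S →ₗ[S] S)) := by
      have h1' : LinearMap.ker (f ^ a • (LinearMap.id : S →ₗ[S] S)) =
        LinearMap.ker (f ^ (a + k) • (LinearMap.id : S →ₗ[S] S)) := h1
      rw [h1']; exact h2
    exact h3
  obtain ⟨k0, hk0⟩ := Ideal.exists_pow_inf_eq_pow_smul b (Ideal.span {f ^ (a + k)} : Submodule S S)
  have hAR : ∀ r : S, f ^ (a + k) * r ∈ b ^ (k0 + c) → ∃ s ∈ b ^ c, f ^ (a + k) * r =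
      f ^ (a + k) * s := by
    intro r hr
    have h1 : f ^ (a + k) * r ∈ b ^ (k0 + c) • (⊤ : Submodule S S) ⊓ Ideal.span {f ^ (a + k)} :=
      ⟨by simpa using hr, Ideal.mul_mem_right _ _ (Ideal.mem_span_singleton_self _)⟩
    rw [hk0 _ (Nat.le_add_right _ _), Nat.add_sub_cancel_left] at h1
    have h2 : f ^ (a + k) * r ∈ b ^ c • (Ideal.span {f ^ (a + k)} : Submodule S S) :=
      by
      have h3 : b ^ c • (b ^ k0 • (⊤ : Submodule S S) ⊓ Ideal.span {f ^ (a + k)}) ≤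
        b ^ c • (Ideal.span {f ^ (a + k)} : Submodule S S) := smul_mono_right _ inf_le_right
      exact h3 h1
    rw [smul_eq_mul, Ideal.mem_mul_span_singleton] at h2
    obtain ⟨s, hs, hs'⟩ := h2
    exact ⟨s, hs, by rw [← hs', mul_comm]⟩
  let α : S →ₗ[S] S ⧸ b ^ (k0 + c) := Submodule.mkQ (b ^ (k0 + c)) ∘ₗ (f ^ (a + k) • LinearMap.id)
  let β : S →ₗ[S] E := LinearMap.toSpanSingleton S E (f ^ a • x)
  obtain ⟨φ, hφ⟩ := inj_factor α β (by
    intro r hr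
    have hr' : f ^ (a + k) * r ∈ b ^ (k0 + c) := (Submodule.Quotient.mk_eq_zero _).1 hr
    obtain ⟨s, hs, hrs⟩ := hAR r hr'
    have h1 := ha' (r - s) (by rw [mul_sub, hrs, sub_self])
    change r • f ^ a • x = 0
    rw [smul_smul, mul_comm, show f ^ a * r = f ^ a * s by rw [← sub_eq_zero, ← mul_sub, h1],
      mul_smul, hx s hs, smul_zero])
  refine ⟨φ (Submodule.Quotient.mk 1), a, k0 + c, ?_, ?_⟩
  · intro r hr
    rw [← map_smul, ← Submodule.Quotient.mk_smul, smul_eq_mul, mul_one,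
      (Submodule.Quotient.mk_eq_zero _).2 hr, map_zero]
  · have h1 := hφ 1
    have h2 : β 1 = f ^ a • x := LinearMap.toSpanSingleton_apply_one S E _
    rw [← h2, ← h1, ← map_smul]
    rfl

namespace Cx

theorem K_inj [IsNoetherianRing S] (E : Type u) [AddCommGroup E] [Module S E]
    [Module.Injective S E] (fs : List S) (i : ℕ) (x : (K E fs).X (i + 2))
    (hx : (K E fs).d (i + 2) x = 0) : ∃ w, (K E fs).d (i + 1) w = x := by
  induction fs generalizing i with
  | nil => exact ⟨0, rfl⟩
  | cons f fs ih =>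
    obtain ⟨x, y⟩ := x
    have hx1 : (K E fs).d (i + 2) x = 0 := congrArg Prod.fst hx
    have hx2 : lι f _ x - lmap f ((K E fs).d (i + 1)) y = 0 := congrArg Prod.snd hx
    obtain ⟨w, hw⟩ := ih i x hx1
    have h2 : lmap f ((K E fs).d (i + 1)) (y - lι f _ w) = 0 := by
      rw [map_sub, lmap_lι, hw, ← neg_sub, hx2, neg_zero]
    obtain ⟨l, y0, hy0⟩ := Loc.exists_pow f (y - lι f _ w)
    have h3 : lι f _ ((K E fs).d (i + 1) y0) = 0 := by
      rw [← lmap_lι, ← hy0, map_smul, h2, smul_zero]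
    obtain ⟨m, hm⟩ := (lι_eq_zero f _).1 h3
    rw [← map_smul] at hm
    match i with
    | 0 =>
      -- `z = f ^ m • y0` is a cocycle in degree zero
      have hz := (K_one E fs _).1 hm
      set z := Ke E fs (f ^ m • y0) with hzdef
      have hrad : Ideal.span {g | g ∈ fs} ≤ (Ideal.torsionOf S _ z).radical := by
        rw [Ideal.span_le]
        intro g hg
        obtain ⟨k, hk⟩ := hz g hg
        exact ⟨k, (Ideal.mem_torsionOf_iff _ _).2 hk⟩
      obtain ⟨c, hc⟩ := Ideal.exists_pow_le_of_le_radical_of_fg hrad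
        (Submodule.fg_span (List.finite_toSet fs))
      obtain ⟨v, a, N, hv, hva⟩ := inj_div (Ideal.span {g | g ∈ fs}) f z c (m + l)
        (fun r hr => (Ideal.mem_torsionOf_iff _ _).1 (hc hr))
      let v' := (Ke E fs).symm v
      have hv' : (K E fs).d 1 v' = 0 := by
        rw [K_one]
        intro g hg
        exact ⟨N, by
          rw [LinearEquiv.apply_symm_apply]
          exact hv _ (Ideal.pow_mem_pow (Ideal.subset_span (show g ∈ {g | g ∈ fs} from hg)) N)⟩
      have hva' : f ^ (a + (m + l)) • v' = f ^ a • f ^ m • y0 := by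
        apply (Ke E fs).injective
        rw [map_smul, LinearEquiv.apply_symm_apply, hva, map_smul]
      refine ⟨(w + v', 0), Prod.ext ?_ ?_⟩
      · change (K E fs).d 1 (w + v') = x
        rw [map_add, hv', add_zero, hw]
      · change lι f _ (w + v') - lmap f ((K E fs).d 0) 0 = y
        rw [map_zero, sub_zero, map_add]
        refine add_eq_of_eq_sub' ?_
        apply Loc.pow_inj f (a + (m + l))
        rw [← map_smul, hva', map_smul, map_smul, ← hy0, smul_smul, smul_smul, pow_add, pow_add,
          mul_assoc]
    | i + 1 =>
      obtain ⟨v, hv⟩ := ih i _ hm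
      obtain ⟨v', hv'⟩ := Loc.pow_surj f (m + l) (lι f _ v)
      refine ⟨(w, - v'), Prod.ext hw ?_⟩
      change lι f _ w - lmap f ((K E fs).d (i + 1)) (- v') = y
      rw [map_neg, sub_neg_eq_add]
      refine add_eq_of_eq_sub' ?_
      apply Loc.pow_inj f (m + l)
      rw [← map_smul, hv', lmap_lι, hv, map_smul, ← hy0, smul_smul, pow_add]

end Cx
end


set_option linter.unusedSectionVars false

section bc
open TensorProduct
variable {R : Type u} [CommRing R] (S : Type u) [CommRing S] [Algebra R S]

instance bcLoc (f : R) (X : Type u) [AddCommGroup X] [Module R X] :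
    IsLocalizedModule (Submonoid.powers f) ((lι f X).lTensor S) := by
  have h : IsLocalizedModule (Submonoid.powers f) (AlgebraTensorModule.rTensor R S (lι f X)) :=
    inferInstance
  have h1 : (lι f X).lTensor S = (TensorProduct.comm R (Loc f X) S).toLinearMap ∘ₗ
      (AlgebraTensorModule.rTensor R S (lι f X)) ∘ₗ (TensorProduct.comm R S X).toLinearMap := by
    ext; rfl
  rw [h1]
  have h2 := IsLocalizedModule.of_linearEquiv_right (Submonoid.powers f)
    (AlgebraTensorModule.rTensor R S (lι f X)) (TensorProduct.comm R S X)
  exact IsLocalizedModule.of_linearEquiv (Submonoid.powers f) _ (TensorProduct.comm R (Loc f X) S)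

variable (f : R) (X : Type u) [AddCommGroup X] [Module R X]

theorem alg_pow_smul (k : ℕ) (Y : Type u) [AddCommGroup Y] [Module R Y] (z : S ⊗[R] Y) :
    (algebraMap R S f) ^ k • z = f ^ k • z := by
  rw [← map_pow, algebraMap_smul]

theorem bcLoc_units (x : Submonoid.powers (algebraMap R S f)) :
    IsUnit (algebraMap S (Module.End S (S ⊗[R] Loc f X)) x) := by
  obtain ⟨_, k, rfl⟩ := x
  rw [Module.End.isUnit_iff]
  have := (Module.End.isUnit_iff _).1 (IsLocalizedModule.map_units ((lι f X).lTensor S)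
    (⟨f ^ k, k, rfl⟩ : Submonoid.powers f))
  have e : ((algebraMap S (Module.End S (S ⊗[R] Loc f X)) (algebraMap R S f ^ k) :
      S ⊗[R] Loc f X → S ⊗[R] Loc f X)) =
      (algebraMap R (Module.End R (S ⊗[R] Loc f X)) (f ^ k) : S ⊗[R] Loc f X → S ⊗[R] Loc f X) := by
    funext z
    exact alg_pow_smul S f k _ z
  have h' := this
  change Function.Bijective
    (algebraMap R (Module.End R (S ⊗[R] Loc f X)) (f ^ k) : S ⊗[R] Loc f X → S ⊗[R] Loc f X) at h'
  rw [← e] at h'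
  exact h'

noncomputable def bcμ : Loc (algebraMap R S f) (S ⊗[R] X) →ₗ[S] S ⊗[R] Loc f X :=
  IsLocalizedModule.lift (Submonoid.powers (algebraMap R S f)) (lι (algebraMap R S f) (S ⊗[R] X))
    ((lι f X).baseChange S) (bcLoc_units S f X)

theorem bcμ_lι (x : S ⊗[R] X) :
    bcμ S f X (lι (algebraMap R S f) (S ⊗[R] X) x) = (lι f X).baseChange S x :=
  IsLocalizedModule.lift_apply _ _ _ _ x

theorem bcμ_bij : Function.Bijective (bcμ S f X) := by
  constructor
  · rw [injective_iff_map_eq_zero]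
    intro y hy
    obtain ⟨k, x, hx⟩ := Loc.exists_pow _ y
    have h1 : (lι f X).lTensor S x = 0 := by
      change (lι f X).baseChange S x = 0
      rw [← bcμ_lι, ← hx, map_smul, hy, smul_zero]
    rw [IsLocalizedModule.eq_zero_iff (Submonoid.powers f)] at h1
    obtain ⟨⟨_, m, rfl⟩, hm⟩ := h1
    apply Loc.pow_inj _ k
    rw [hx, smul_zero, lι_eq_zero]
    refine ⟨m, ?_⟩
    rw [alg_pow_smul]
    exact hm
  · intro z
    obtain ⟨⟨x, ⟨_, k, rfl⟩⟩, h⟩ := IsLocalizedModule.surj (Submonoid.powers f)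
      ((lι f X).lTensor S) z
    obtain ⟨y, hy⟩ := Loc.pow_surj (algebraMap R S f) k (lι (algebraMap R S f) (S ⊗[R] X) x)
    refine ⟨y, ?_⟩
    apply ((Module.End.isUnit_iff _).1 (bcLoc_units S f X ⟨_, k, rfl⟩)).1
    change algebraMap R S f ^ k • (bcμ S f X y) = algebraMap R S f ^ k • z
    rw [← map_smul, hy, bcμ_lι, alg_pow_smul]
    exact h.symm

variable {X} in
theorem bcμ_nat {Y : Type u} [AddCommGroup Y] [Module R Y] (g : X →ₗ[R] Y)
    (y : Loc (algebraMap R S f) (S ⊗[R] X)) :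
    bcμ S f Y (lmap (algebraMap R S f) (g.baseChange S) y) =
      (lmap f g).baseChange S (bcμ S f X y) := by
  obtain ⟨k, x, hx⟩ := Loc.exists_pow _ y
  apply ((Module.End.isUnit_iff _).1 (bcLoc_units S f Y ⟨_, k, rfl⟩)).1
  change algebraMap R S f ^ k • (bcμ S f Y (lmap (algebraMap R S f) (g.baseChange S) y)) =
    algebraMap R S f ^ k • ((lmap f g).baseChange S (bcμ S f X y))
  rw [← map_smul, ← map_smul, ← map_smul, ← map_smul, hx, lmap_lι, bcμ_lι, bcμ_lι]
  rw [← LinearMap.comp_apply, ← LinearMap.comp_apply, ← LinearMap.baseChange_comp,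
    ← LinearMap.baseChange_comp]
  congr 2
  ext x
  simp

namespace Cx

/-- base change of a complex -/
noncomputable def bc (C : Cx R) : Cx S where
  X := fun i => ModuleCat.of S (S ⊗[R] C.X i)
  d := fun i => (C.d i).baseChange S
  dd := by
    intro i x
    have h0 : C.d (i + 1) ∘ₗ C.d i = 0 := LinearMap.ext (C.dd i)
    change ((C.d (i + 1)).baseChange S ∘ₗ (C.d i).baseChange S) x = 0
    rw [← LinearMap.baseChange_comp, h0, LinearMap.baseChange_zero]
    rfl

variable {S} in
def IsoCx (C D : Cx S) : Prop := ∃ φ : Hom C D, ∀ i, Function.Bijective (φ.f i)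

variable {S} in
theorem IsoCx.trans {C D E : Cx S} (h : IsoCx C D) (h' : IsoCx D E) : IsoCx C E := by
  obtain ⟨φ, hφ⟩ := h
  obtain ⟨ψ, hψ⟩ := h'
  exact ⟨⟨fun i => ψ.f i ∘ₗ φ.f i, fun i x => by simp [φ.comm, ψ.comm]⟩,
    fun i => (hψ i).comp (hφ i)⟩

variable {S} in
theorem IsoCx.step {C D : Cx S} (h : IsoCx C D) (f : S) : IsoCx (step f C) (step f D) := by
  obtain ⟨φ, hφ⟩ := h
  refine ⟨stepHom f φ, fun i => ?_⟩
  match i with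
  | 0 => exact hφ 0
  | i + 1 => exact (hφ (i + 1)).prodMap ⟨lmap_inj f _ (hφ i).1, lmap_surj f _ (hφ i).2⟩

variable {S} in
theorem IsoCx.hmap_bij {C D : Cx S} (φ : Hom C D) (hφ : ∀ i, Function.Bijective (φ.f i)) (i : ℕ) :
    Function.Bijective (hmap φ i) := by
  constructor
  · rw [injective_iff_map_eq_zero]
    intro a ha
    obtain ⟨x, rfl⟩ := hproj_surj _ _ a
    rw [hmap_hproj, hproj_eq_zero] at ha
    obtain ⟨w, hw⟩ := ha
    obtain ⟨v, rfl⟩ := (hφ i).2 w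
    rw [← φ.comm, zmap_coe] at hw
    exact (hproj_eq_zero _ _ _).2 ⟨v, (hφ (i + 1)).1 hw⟩
  · intro a
    obtain ⟨⟨x, hx⟩, rfl⟩ := hproj_surj _ _ a
    obtain ⟨v, rfl⟩ := (hφ (i + 1)).2 x
    have hv : C.d (i + 1) v = 0 := by
      apply (hφ (i + 2)).1
      rw [φ.comm, map_zero]
      exact hx
    exact ⟨hproj _ _ ⟨v, hv⟩, rfl⟩

noncomputable def bcStepHom (f : R) (C : Cx R) :
    Hom (step (algebraMap R S f) (bc S C)) (bc S (step f C)) where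
  f := fun i => match i with
    | 0 => (LinearMap.id : S ⊗[R] C.X 0 →ₗ[S] S ⊗[R] C.X 0)
    | i + 1 => (TensorProduct.prodRight R S S (C.X (i + 1)) (Loc f (C.X i))).symm.toLinearMap ∘ₗ
        LinearMap.prodMap (LinearMap.id : S ⊗[R] C.X (i + 1) →ₗ[S] S ⊗[R] C.X (i + 1))
          (bcμ S f (C.X i))
  comm := by
    rintro (_ | i) x
    · apply (TensorProduct.prodRight R S S (C.X 1) (Loc f (C.X 0))).injective
      refine Eq.trans (LinearEquiv.apply_symm_apply _ _) ?_
      have h1 : ∀ x : S ⊗[R] C.X 0,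
          (TensorProduct.prodRight R S S (C.X 1) (Loc f (C.X 0)))
            ((LinearMap.prod (C.d 0) (lι f (C.X 0))).baseChange S x) =
          ((C.d 0).baseChange S x, (lι f (C.X 0)).baseChange S x) := by
        intro x
        induction x with
        | zero => simp; rfl
        | add x y hx hy => rw [map_add, map_add, hx, hy, map_add, map_add]; rfl
        | tmul s x => simp
      refine Eq.trans ?_ (h1 x).symm
      exact Prod.ext rfl (bcμ_lι S f (C.X 0) x)
    · obtain ⟨x, y⟩ := x
      apply (TensorProduct.prodRight R S S (C.X (i + 2)) (Loc f (C.X (i + 1)))).injective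
      refine Eq.trans (LinearEquiv.apply_symm_apply _ _) ?_
      have h1 : ∀ z : S ⊗[R] (C.X (i + 1) × Loc f (C.X i)),
          (TensorProduct.prodRight R S S (C.X (i + 2)) (Loc f (C.X (i + 1))))
            ((LinearMap.prod (C.d (i + 1) ∘ₗ LinearMap.fst R (C.X (i + 1)) (Loc f (C.X i)))
              (lι f (C.X (i + 1)) ∘ₗ LinearMap.fst R (C.X (i + 1)) (Loc f (C.X i)) -
        lmap f (C.d i) ∘ₗ LinearMap.snd R (C.X (i + 1)) (Loc f (C.X i)))).baseChange S z) =
          ((C.d (i + 1)).baseChange S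
            (TensorProduct.prodRight R S S (C.X (i + 1)) (Loc f (C.X i)) z).1,
            (lι f (C.X (i + 1))).baseChange S
              (TensorProduct.prodRight R S S (C.X (i + 1)) (Loc f (C.X i)) z).1 -
            (lmap f (C.d i)).baseChange S
              (TensorProduct.prodRight R S S (C.X (i + 1)) (Loc f (C.X i)) z).2) := by
        intro z
        induction z with
        | zero => simp; rfl
        | add x y hx hy =>
          rw [map_add, map_add, hx, hy, map_add]
          refine Prod.ext ?_ ?_
          · simp
          · simp only [Prod.snd_add, Prod.fst_add, map_add]
            abel
        | tmul s x =>
          obtain ⟨x, y⟩ := x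
          refine Prod.ext rfl ?_
          change s ⊗ₜ[R] (lι f _ x - lmap f (C.d i) y) = s ⊗ₜ[R] _ - s ⊗ₜ[R] _
          rw [TensorProduct.tmul_sub]
          rfl
      refine Eq.trans ?_ (h1 ((TensorProduct.prodRight R S S (C.X (i + 1))
        (Loc f (C.X i))).symm (x, bcμ S f _ y))).symm
      rw [LinearEquiv.apply_symm_apply]
      refine Prod.ext rfl ?_
      exact (map_sub (bcμ S f (C.X (i + 1))) _ _).trans
        (congrArg₂ _ (bcμ_lι S f (C.X (i + 1)) x) (bcμ_nat S f (C.d i) y))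

theorem bcStep (f : R) (C : Cx R) :
    IsoCx (step (algebraMap R S f) (bc S C)) (bc S (step f C)) := by
  refine ⟨bcStepHom S f C, fun i => ?_⟩
  match i with
  | 0 => exact Function.bijective_id
  | i + 1 =>
    exact (TensorProduct.prodRight R S S (C.X (i + 1)) (Loc f (C.X i))).symm.bijective.comp
      (Function.bijective_id.prodMap (bcμ_bij S f (C.X i)))

theorem bcBase (N : Type u) [AddCommGroup N] [Module R N] :
    IsoCx (base (S ⊗[R] N) : Cx S) (bc S (base N : Cx R)) := by
  have hs : Subsingleton (S ⊗[R] PUnit.{u+1}) :=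
    ⟨fun a b => by
      have : ∀ a : S ⊗[R] PUnit.{u+1}, a = 0 := by
        intro a
        induction a with
        | zero => rfl
        | add x y hx hy => rw [hx, hy, add_zero]
        | tmul s x => exact TensorProduct.tmul_zero _ s
      rw [this a, this b]⟩
  refine ⟨⟨fun i => match i with
    | 0 => 0
    | 1 => (LinearMap.id : S ⊗[R] N →ₗ[S] S ⊗[R] N)
    | _ + 2 => 0, ?_⟩, ?_⟩
  · intro i x
    have h1 : (base (S ⊗[R] N) : Cx S).d i x = 0 := rfl
    have h2 : ∀ y, (bc S (base N : Cx R)).d i y = 0 := by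
      intro y
      change LinearMap.baseChange S (0 : (base N : Cx R).X i →ₗ[R] _) y = 0
      rw [LinearMap.baseChange_zero]
      rfl
    rw [h1, h2, map_zero]
  · intro i
    match i with
    | 0 => exact ⟨fun _ _ _ => rfl, fun y => ⟨PUnit.unit, hs.elim _ _⟩⟩
    | 1 => exact Function.bijective_id
    | _ + 2 => exact ⟨fun _ _ _ => rfl, fun y => ⟨PUnit.unit, hs.elim _ _⟩⟩

theorem bcK (N : Type u) [AddCommGroup N] [Module R N] (fs : List R) :
    IsoCx (K (S ⊗[R] N) (fs.map (algebraMap R S))) (bc S (K N fs)) := by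
  induction fs with
  | nil => exact bcBase S N
  | cons f fs ih => exact (ih.step _).trans (bcStep S f _)

theorem bc_kill [Module.Flat R S] (C : Cx R) (i : ℕ) (a : R) (h : ∀ x : H C i, a • x = 0)
    (x : H (bc S C) i) : algebraMap R S a • x = 0 := by
  obtain ⟨⟨z, hz⟩, rfl⟩ := hproj_surj _ _ x
  have hex := Module.Flat.lTensor_exact S
    (LinearMap.exact_subtype_ker_map (C.d (i + 1)))
  obtain ⟨t, rfl⟩ := (hex z).1 hz
  rw [← map_smul, hproj_eq_zero]
  change ∃ w : S ⊗[R] C.X i, (C.d i).baseChange S w = algebraMap R S a •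
    ((LinearMap.ker (C.d (i + 1))).subtype.lTensor S t)
  clear hz
  induction t with
  | zero => exact ⟨0, by simp⟩
  | add x y hx hy =>
    obtain ⟨u, hu⟩ := hx
    obtain ⟨v, hv⟩ := hy
    exact ⟨u + v, by rw [map_add, hu, hv, map_add, smul_add]⟩
  | tmul s k =>
    obtain ⟨w, hw⟩ := (hproj_eq_zero C i (a • k)).1 (by rw [map_smul]; exact h _)
    refine ⟨s ⊗ₜ w, ?_⟩
    rw [algebraMap_smul]
    change s ⊗ₜ[R] (C.d i w) = a • (s ⊗ₜ[R] (k : C.X (i + 1)))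
    rw [hw, ← TensorProduct.tmul_smul]
    rfl

theorem bc_reflect [Module.FaithfullyFlat R S] (C : Cx R) (i : ℕ)
    (h : Subsingleton (H (bc S C) i)) : Subsingleton (H C i) := by
  have h1 : Function.Exact ((C.d i).lTensor S) ((C.d (i + 1)).lTensor S) := by
    intro z
    constructor
    · intro hz
      exact exact_of_H_sub (bc S C) i h z hz
    · rintro ⟨w, rfl⟩
      exact (bc S C).dd i w
  have h2 := (Module.FaithfullyFlat.lTensor_exact_iff_exact R S _ _).1 h1
  exact H_sub C i (fun x hx => (h2 x).1 hx)

end Cx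
end bc


set_option linter.unusedSectionVars false

section compl
open IsLocalRing

/-- a complete ring whose ideal of definition comes from a Noetherian ring with surjective residue
map is Noetherian -/
theorem noeth_of_complete {R T : Type u} [CommRing R] [IsNoetherianRing R] [CommRing T] [Algebra R T]
    (n : Ideal T) [IsAdicComplete n T] (r : ℕ) (x : Fin r → R)
    (hx : n = Ideal.span (Set.range fun i => algebraMap R T (x i)))
    (hs : ∀ t : T, ∃ a : R, t - algebraMap R T a ∈ n) : IsNoetherianRing T := by
  classical
  let A := MvPolynomial (Fin r) R
  let J : Ideal A := MvPolynomial.idealOfVars (Fin r) R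
  let φ : A →+* T := (MvPolynomial.aeval fun i => algebraMap R T (x i) : A →ₐ[R] T).toRingHom
  have hJ : J ≤ n.comap φ := by
    change Ideal.span (Set.range MvPolynomial.X) ≤ _
    rw [Ideal.span_le]
    rintro _ ⟨i, rfl⟩
    change φ (MvPolynomial.X i) ∈ n
    have : φ (MvPolynomial.X i) = algebraMap R T (x i) := MvPolynomial.aeval_X _ i
    rw [this, hx]
    exact Ideal.subset_span ⟨i, rfl⟩
  have hJk : ∀ k, J ^ k ≤ (n ^ k).comap φ := fun k =>
    (Ideal.pow_right_mono hJ k).trans (Ideal.le_comap_pow φ k)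
  let f : (k : ℕ) → MvPowerSeries (Fin r) R →+* T ⧸ n ^ k := fun k =>
    (Ideal.quotientMap (n ^ k) φ (hJk k)).comp (MvPowerSeries.truncTotalAlgHom (Fin r) R k).toRingHom
  have hfk : ∀ k p, f k p = Ideal.Quotient.mk _ (φ (MvPowerSeries.truncTotal k p)) :=
    fun k p => rfl
  have hf : ∀ {a b : ℕ} (hle : a ≤ b), (Ideal.Quotient.factorPow n hle).comp (f b) = f a := by
    intro a b hle
    ext p
    rw [RingHom.comp_apply, hfk, hfk]
    change Ideal.Quotient.mk (n ^ a) _ = _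
    rw [Ideal.Quotient.mk_eq_mk_iff_sub_mem, ← map_sub]
    exact hJk a (MvPowerSeries.truncTotal_sub_truncTotal_mem_pow_idealOfVars hle le_rfl p)
  let F := IsAdicComplete.liftRingHom n f hf
  have hF : ∀ p : A, F (p : MvPowerSeries (Fin r) R) = φ p := by
    intro p
    rw [← sub_eq_zero]
    apply IsHausdorff.haus (I := n) inferInstance
    intro k
    rw [smul_eq_mul, Ideal.mul_top, SModEq.zero, ← Ideal.Quotient.mk_eq_mk_iff_sub_mem,
      IsAdicComplete.mk_liftRingHom, hfk, Ideal.Quotient.mk_eq_mk_iff_sub_mem, ← map_sub]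
    apply hJk k
    rw [MvPolynomial.mem_pow_idealOfVars_iff']
    intro y hy
    rw [MvPolynomial.coeff_sub, sub_eq_zero, MvPowerSeries.coeff_truncTotal _ hy,
      MvPolynomial.coeff_coe]
  have hI : (Ideal.span (Set.range MvPowerSeries.X) : Ideal (MvPowerSeries (Fin r) R)).map F = n := by
    rw [Ideal.map_span, ← Set.range_comp, hx]
    congr 2
    funext i
    have := hF (MvPolynomial.X i)
    rw [MvPolynomial.coe_X] at this
    exact this.trans (MvPolynomial.aeval_X _ i)
  have hH : IsHausdorff
      ((Ideal.span (Set.range MvPowerSeries.X) : Ideal (MvPowerSeries (Fin r) R)).map F) T := by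
    rw [hI]; infer_instance
  have hsurj : Function.Surjective F := by
    refine surjective_of_mk_map_comp_surjective
      (I := (Ideal.span (Set.range MvPowerSeries.X) : Ideal (MvPowerSeries (Fin r) R))) F ?_
    intro t
    obtain ⟨t, rfl⟩ := Ideal.Quotient.mk_surjective t
    obtain ⟨a, ha⟩ := hs t
    refine ⟨(MvPolynomial.C a : A), ?_⟩
    rw [RingHom.comp_apply, hF, eq_comm, Ideal.Quotient.mk_eq_mk_iff_sub_mem, hI]
    have : φ (MvPolynomial.C a) = algebraMap R T a := MvPolynomial.aeval_C _ a
    rw [this]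
    exact ha
  exact isNoetherianRing_of_surjective _ _ F hsurj

variable (R : Type u) [CommRing R] [IsNoetherianRing R] [IsLocalRing R]

instance complNoeth : IsNoetherianRing (AdicCompletion (maximalIdeal R) R) := by
  obtain ⟨r, x, hx⟩ := Submodule.fg_iff_exists_fin_generating_family.1
    (IsNoetherian.noetherian (maximalIdeal R))
  refine noeth_of_complete (R := R) (maximalIdeal (AdicCompletion (maximalIdeal R) R)) r x ?_ ?_
  · rw [AdicCompletion.maximalIdeal_eq_map]
    have h1 := congrArg (Ideal.map (algebraMap R (AdicCompletion (maximalIdeal R) R))) hx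
    rw [← h1]
    change Ideal.map _ (Ideal.span _) = _
    rw [Ideal.map_span, ← Set.range_comp]
    rfl
  · intro t
    obtain ⟨z, hz⟩ := (AdicCompletion.residueField_map_bijective R).2 (residue _ t)
    obtain ⟨a, rfl⟩ := residue_surjective z
    refine ⟨a, ?_⟩
    rw [IsLocalRing.ResidueField.map_residue] at hz
    exact (Ideal.Quotient.mk_eq_mk_iff_sub_mem _ _).1 hz.symm

instance complFF : Module.FaithfullyFlat R (AdicCompletion (maximalIdeal R) R) :=
  Module.FaithfullyFlat.of_flat_of_isLocalHom

theorem compl_dim : ringKrullDim (AdicCompletion (maximalIdeal R) R) ≤ ringKrullDim R := by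
  rw [← IsLocalRing.maximalIdeal_height_eq_ringKrullDim,
    ← IsLocalRing.maximalIdeal_height_eq_ringKrullDim]
  have : (maximalIdeal (AdicCompletion (maximalIdeal R) R)).LiesOver (maximalIdeal R) :=
    ⟨(IsLocalRing.maximalIdeal_comap (algebraMap R (AdicCompletion (maximalIdeal R) R))).symm⟩
  have h := Ideal.height_le_height_add_of_liesOver (maximalIdeal R)
    (maximalIdeal (AdicCompletion (maximalIdeal R) R))
  rw [← AdicCompletion.maximalIdeal_eq_map, Ideal.map_quotient_self] at h
  have h0 : (⊥ : Ideal (AdicCompletion (maximalIdeal R) R ⧸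
      maximalIdeal (AdicCompletion (maximalIdeal R) R))).height = 0 := by
    let _ := Ideal.Quotient.field (maximalIdeal (AdicCompletion (maximalIdeal R) R))
    simp
  rw [h0, add_zero] at h
  exact_mod_cast h
end compl

set_option linter.unusedSectionVars false

namespace ExtCmp
open Abelian Limits

variable {R : Type u} [CommRing R]

section
variable {X : ModuleCat.{u} R} (P : ProjectiveResolution X) (Y : ModuleCat.{u} R) (n : ℕ)

lemma cyc_d (z : (P.complex.linearYonedaObj R Y).cycles n) :
    P.complex.d (n+1) n ≫
      (show P.complex.X n ⟶ Y from (P.complex.linearYonedaObj R Y).iCycles n z) = 0 := by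
  have h := (P.complex.linearYonedaObj R Y).iCycles_d n (n+1)
  have := ConcreteCategory.congr_hom h z
  exact this

noncomputable def qf : (P.complex.linearYonedaObj R Y).cycles n →ₗ[R] Abelian.Ext X Y n where
  toFun z := P.extMk (show P.complex.X n ⟶ Y from (P.complex.linearYonedaObj R Y).iCycles n z)
    (n+1) rfl (cyc_d P Y n z)
  map_add' z w := by
    rw [P.add_extMk]
    congr 1
    exact map_add ((P.complex.linearYonedaObj R Y).iCycles n).hom z w
  map_smul' r z := by
    rw [RingHom.id_apply, Ext.smul_eq_comp_mk₀, P.extMk_comp_mk₀]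
    congr 1
    refine (map_smul ((P.complex.linearYonedaObj R Y).iCycles n).hom r z).trans ?_
    rw [Linear.comp_smul, Category.comp_id]
    rfl

lemma exists_cyc (f : P.complex.X n ⟶ Y) (hf : P.complex.d (n+1) n ≫ f = 0) :
    ∃ z : (P.complex.linearYonedaObj R Y).cycles n,
      (P.complex.linearYonedaObj R Y).iCycles n z = f := by
  let C := P.complex.linearYonedaObj R Y
  have h : C.d n (n+1) f = 0 := hf
  let k : ModuleCat.of R R ⟶ C.X n := ModuleCat.ofHom (LinearMap.toSpanSingleton R (C.X n) f)
  have hk : k ≫ C.d n (n+1) = 0 := by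
    ext
    change C.d n (n+1) ((1 : R) • f) = 0
    rw [one_smul]; exact h
  refine ⟨C.liftCycles k (n+1) (by simp) hk (1 : R), ?_⟩
  have := ConcreteCategory.congr_hom (C.liftCycles_i k (n+1) (by simp) hk) (1 : R)
  refine this.trans ?_
  change (1 : R) • f = f
  rw [one_smul]

lemma qf_surj : Function.Surjective (qf P Y n) := by
  intro x
  obtain ⟨f, hf, rfl⟩ := P.extMk_surjective x (n+1) rfl
  obtain ⟨z, rfl⟩ := exists_cyc P Y n f hf
  exact ⟨z, rfl⟩

noncomputable def pf : (P.complex.linearYonedaObj R Y).cycles n →ₗ[R]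
    ((Ext R (ModuleCat.{u} R) n).obj (Opposite.op X)).obj Y :=
  ((P.complex.linearYonedaObj R Y).homologyπ n ≫ (P.isoExt (R := R) n Y).inv).hom

lemma pf_surj : Function.Surjective (pf P Y n) := by
  have : Epi ((P.complex.linearYonedaObj R Y).homologyπ n ≫ (P.isoExt (R := R) n Y).inv) :=
    inferInstance
  exact (ModuleCat.epi_iff_surjective _).1 this

lemma pf_eq_zero (z) : pf P Y n z = 0 ↔ (P.complex.linearYonedaObj R Y).homologyπ n z = 0 := by
  constructor
  · intro h
    have h2 : (P.isoExt (R := R) n Y).inv ((P.complex.linearYonedaObj R Y).homologyπ n z) = 0 := h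
    have h3 := congrArg (P.isoExt (R := R) n Y).hom h2
    simpa using h3
  · intro h
    change (P.isoExt (R := R) n Y).inv ((P.complex.linearYonedaObj R Y).homologyπ n z) = 0
    rw [h, map_zero]

lemma hpi_eq_zero (C : CochainComplex (ModuleCat.{u} R) ℕ) (n : ℕ) (z : C.cycles n) :
    C.homologyπ n z = 0 ↔ ∃ w, C.d ((ComplexShape.up ℕ).prev n) n w = C.iCycles n z := by
  have hex := (ShortComplex.moduleCat_exact_iff _).1
    (ShortComplex.exact_of_g_is_cokernel (ShortComplex.mk _ _ (C.toCycles_comp_homologyπ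
      ((ComplexShape.up ℕ).prev n) n)) (C.homologyIsCokernel _ n rfl))
  have hinj : Function.Injective (C.iCycles n) :=
    (ModuleCat.mono_iff_injective _).1 inferInstance
  constructor
  · intro h
    obtain ⟨w, hw⟩ := hex z h
    refine ⟨w, ?_⟩
    have := ConcreteCategory.congr_hom (C.toCycles_i ((ComplexShape.up ℕ).prev n) n) w
    rw [← this]
    exact congrArg _ hw
  · rintro ⟨w, hw⟩
    have h1 : C.toCycles ((ComplexShape.up ℕ).prev n) n w = z := by
      apply hinj
      rw [← hw]
      exact ConcreteCategory.congr_hom (C.toCycles_i ((ComplexShape.up ℕ).prev n) n) w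
    rw [← h1]
    exact ConcreteCategory.congr_hom (C.toCycles_comp_homologyπ ((ComplexShape.up ℕ).prev n) n) w

lemma extMk_zero_iff (f : P.complex.X 0 ⟶ Y) (hf : P.complex.d 1 0 ≫ f = 0) :
    P.extMk f 1 rfl hf = 0 ↔ f = 0 := by
  constructor
  · intro h
    have h2 := congrArg P.extEquivCohomologyClass h
    rw [P.extEquivCohomologyClass_extMk, P.extEquivCohomologyClass_zero,
      CochainComplex.HomComplex.CohomologyClass.mk_eq_zero_iff,
      CochainComplex.HomComplex.Cocycle.toSingleMk_mem_coboundaries_iff _ _ _ _ _ 1 (by simp)] at h2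
    obtain ⟨g, hg⟩ := h2
    have hz : IsZero (P.cochainComplex.X 1) := by
      exact CochainComplex.isZero_of_isStrictlyLE _ 0 1 (by norm_num)
    rw [hz.eq_of_src g 0, comp_zero] at hg
    rw [← cancel_epi (P.cochainComplexXIso (-(0:ℕ)) 0 rfl).hom, ← hg, comp_zero]
  · rintro rfl
    exact P.extMk_zero _ _

lemma qf_eq_zero (z) : qf P Y n z = 0 ↔ pf P Y n z = 0 := by
  rw [pf_eq_zero, hpi_eq_zero]
  rcases n with _ | n
  · refine (extMk_zero_iff P Y _ (cyc_d P Y 0 z)).trans ?_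
    have h0 : (P.complex.linearYonedaObj R Y).d ((ComplexShape.up ℕ).prev 0) 0 = 0 :=
      HomologicalComplex.shape _ _ _ (by simp)
    rw [h0]
    constructor
    · intro h; exact ⟨0, h.symm⟩
    · rintro ⟨w, hw⟩; exact hw.symm
  · refine (P.extMk_eq_zero_iff _ _ rfl (cyc_d P Y (n+1) z) n rfl).trans ?_
    rw [CochainComplex.prev_nat_succ]
    exact Iff.rfl

end

lemma exists_equiv_of_ker {Z A B : Type u} [AddCommGroup Z] [Module R Z] [AddCommGroup A]
    [Module R A] [AddCommGroup B] [Module R B] (p : Z →ₗ[R] A) (q : Z →ₗ[R] B)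
    (hp : Function.Surjective p) (hq : Function.Surjective q) (h : ∀ z, q z = 0 ↔ p z = 0) :
    ∃ e : A ≃ₗ[R] B, ∀ z, e (p z) = q z := by
  have hk : LinearMap.ker p = LinearMap.ker q := by ext z; simp [h]
  refine ⟨(p.quotKerEquivOfSurjective hp).symm.trans ((Submodule.quotEquivOfEq _ _ hk).trans
    (q.quotKerEquivOfSurjective hq)), fun z => ?_⟩
  have : (p.quotKerEquivOfSurjective hp).symm (p z) = Submodule.Quotient.mk z := by
    rw [LinearEquiv.symm_apply_eq]; rfl
  simp only [LinearEquiv.trans_apply, this]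
  rfl

section
variable {X X' : ModuleCat.{u} R} {P : ProjectiveResolution X} {P' : ProjectiveResolution X'}
  {g : X' ⟶ X} (φ : ProjectiveResolution.Hom P' P g) (Y : ModuleCat.{u} R) (n : ℕ)

noncomputable def Psi : P.complex.linearYonedaObj R Y ⟶ P'.complex.linearYonedaObj R Y where
  f i := ((linearYoneda R (ModuleCat.{u} R)).obj Y).map (φ.hom.f i).op
  comm' i j _ := by
    have h := φ.hom.comm j i
    have h2 := congrArg (fun t => ((linearYoneda R (ModuleCat.{u} R)).obj Y).map t.op) h
    simp only [op_comp, Functor.map_comp] at h2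
    exact h2.symm

lemma qf_nat (z) : qf P' Y n (HomologicalComplex.cyclesMap (Psi φ Y) n z) =
    (Ext.mk₀ g).comp (qf P Y n z) (zero_add n) := by
  have h := P.mk₀_comp_extMk (show P.complex.X n ⟶ Y from
    (P.complex.linearYonedaObj R Y).iCycles n z) (n+1) rfl (cyc_d P Y n z) φ
  refine Eq.trans ?_ h.symm
  have : (P'.complex.linearYonedaObj R Y).iCycles n (HomologicalComplex.cyclesMap (Psi φ Y) n z) =
      (Psi φ Y).f n ((P.complex.linearYonedaObj R Y).iCycles n z) :=
    ConcreteCategory.congr_hom (HomologicalComplex.cyclesMap_i (Psi φ Y) n) z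
  have key : ∀ (f f' : P'.complex.X n ⟶ Y) (h : f = f') (hf hf'),
      P'.extMk f (n+1) rfl hf = P'.extMk f' (n+1) rfl hf' := by
    rintro f f' rfl _ _; rfl
  exact key _ _ this (cyc_d P' Y n (HomologicalComplex.cyclesMap (Psi φ Y) n z)) _

lemma comp_gen {C : Type*} [Category C] {A B B' D D' E' : C} (a : A ⟶ B) (b : A ⟶ B') (b' : B ⟶ D)
    (c : B' ⟶ D') (c' : D ⟶ E') (m : D' ⟶ E') (k : B' ⟶ D) (h1 : c ≫ m = k ≫ c')
    (h2 : b ≫ k = a ≫ b') : a ≫ b' ≫ c' = (b ≫ c) ≫ m := by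
  rw [Category.assoc, h1, ← Category.assoc, ← Category.assoc, h2]

lemma hmap_nat : HomologicalComplex.homologyMap (Psi φ Y) n ≫ (P'.isoExt (R := R) n Y).inv =
    (P.isoExt (R := R) n Y).inv ≫ ((Ext R (ModuleCat.{u} R) n).map g.op).app Y := by
  have h1 := congrArg Quiver.Hom.unop (ProjectiveResolution.isoLeftDerivedObj_hom_naturality g P' P φ.hom
    (by simpa using φ.hom_f_zero_comp_π_f_zero) ((linearYoneda R (ModuleCat.{u} R)).obj Y).rightOp n)
  have h2 := congrArg Quiver.Hom.unop (HomologicalComplex.homologyOp_hom_naturality (Psi φ Y) n)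
  exact comp_gen _ _ _ _ _ _ _ h1 h2

lemma pf_nat (z) : pf P' Y n (HomologicalComplex.cyclesMap (Psi φ Y) n z) =
    ((Ext R (ModuleCat.{u} R) n).map g.op).app Y (pf P Y n z) := by
  have h1 : HomologicalComplex.cyclesMap (Psi φ Y) n ≫ 
      ((P'.complex.linearYonedaObj R Y).homologyπ n ≫ (P'.isoExt (R := R) n Y).inv) =
     ((P.complex.linearYonedaObj R Y).homologyπ n ≫ (P.isoExt (R := R) n Y).inv) ≫
      ((Ext R (ModuleCat.{u} R) n).map g.op).app Y := by
    rw [Category.assoc, ← hmap_nat φ, ← Category.assoc, ← Category.assoc,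
      HomologicalComplex.homologyπ_naturality]
  exact ConcreteCategory.congr_hom h1 z
end

lemma exists_extEquiv (n : ℕ) (Y : ModuleCat.{u} R) :
    ∃ e : ∀ X : ModuleCat.{u} R, ((Ext R (ModuleCat.{u} R) n).obj (Opposite.op X)).obj Y ≃ₗ[R]
      Abelian.Ext X Y n, ∀ (X X' : ModuleCat.{u} R) (g : X' ⟶ X) (x),
        e X' (((Ext R (ModuleCat.{u} R) n).map g.op).app Y x) =
          (Ext.mk₀ g).comp (e X x) (zero_add n) := by
  choose e he using fun X : ModuleCat.{u} R => exists_equiv_of_ker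
    (pf (projectiveResolution X) Y n) (qf (projectiveResolution X) Y n)
    (pf_surj _ _ _) (qf_surj _ _ _) (qf_eq_zero _ _ _)
  refine ⟨e, fun X X' g x => ?_⟩
  obtain ⟨z, rfl⟩ := pf_surj (projectiveResolution X) Y n x
  let φ : ProjectiveResolution.Hom (projectiveResolution X') (projectiveResolution X) g :=
    ⟨ProjectiveResolution.lift g _ _, 
      HomologicalComplex.congr_hom (ProjectiveResolution.lift_commutes g
        (projectiveResolution X') (projectiveResolution X)) 0⟩
  rw [← pf_nat φ, he, he, qf_nat φ]

end ExtCmp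

set_option linter.unusedSectionVars false

namespace ExtCmp
open Abelian Limits

variable {R : Type u} [CommRing R]

abbrev Xq (a : Ideal R) (n : ℕ) : ModuleCat.{u} R := ModuleCat.of R (R ⧸ a ^ n)

abbrev tq (a : Ideal R) {n m : ℕ} (h : n ≤ m) : Xq a m ⟶ Xq a n :=
  ModuleCat.ofHom (Submodule.mapQ _ _ LinearMap.id (Ideal.pow_le_pow_right h))

lemma tq_comp (a : Ideal R) {n m k : ℕ} (h : n ≤ m) (h' : m ≤ k) :
    tq a h' ≫ tq a h = tq a (h.trans h') := by
  apply ModuleCat.hom_ext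
  apply LinearMap.ext
  intro x
  obtain ⟨x, rfl⟩ := Submodule.Quotient.mk_surjective _ x
  rfl

structure Fam (fs : List R) (a : Ideal R) (M : ModuleCat.{u} R) (i : ℕ) where
  θ : ∀ n, Abelian.Ext (Xq a n) M i →ₗ[R] ((Cx.K M fs).H i)
  compat : ∀ {n m} (h : n ≤ m) x, θ m ((Ext.mk₀ (tq a h)).comp x (zero_add i)) = θ n x
  surj : ∀ y, ∃ n x, θ n x = y
  ker : ∀ n x, θ n x = 0 → ∃ m, ∃ h : n ≤ m, (Ext.mk₀ (tq a h)).comp x (zero_add i) = 0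

noncomputable def ev (a : Ideal R) (M : ModuleCat.{u} R) (n : ℕ) :
    Abelian.Ext (Xq a n) M 0 →ₗ[R] M where
  toFun x := (Ext.linearEquiv₀ (R := R) x).hom (Submodule.Quotient.mk 1)
  map_add' x y := by rw [map_add]; rfl
  map_smul' r x := by rw [map_smul]; rfl

lemma ev_mk₀ (a : Ideal R) (M : ModuleCat.{u} R) (n : ℕ) (f : Xq a n ⟶ M) :
    ev a M n (Ext.mk₀ f) = f.hom (Submodule.Quotient.mk 1) := by
  have : Ext.linearEquiv₀ (R := R) (Ext.mk₀ f) = f := by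
    rw [← Ext.linearEquiv₀_symm_apply (R := R), LinearEquiv.apply_symm_apply]
  change (Ext.linearEquiv₀ (R := R) (Ext.mk₀ f)).hom _ = _
  rw [this]

lemma ev_kill (a : Ideal R) (M : ModuleCat.{u} R) (n : ℕ) (x) (r : R) (hr : r ∈ a ^ n) :
    r • ev a M n x = 0 := by
  obtain ⟨f, rfl⟩ := (Ext.mk₀_bijective _ _).2 x
  rw [ev_mk₀, ← map_smul]
  have : r • (Submodule.Quotient.mk 1 : R ⧸ a ^ n) = 0 := by
    rw [← Submodule.Quotient.mk_smul, Submodule.Quotient.mk_eq_zero]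
    simpa using hr
  rw [this, map_zero]

lemma ev_inj (a : Ideal R) (M : ModuleCat.{u} R) (n : ℕ) (x) (h : ev a M n x = 0) : x = 0 := by
  obtain ⟨f, rfl⟩ := (Ext.mk₀_bijective _ _).2 x
  rw [ev_mk₀] at h
  have : f = 0 := by
    apply ModuleCat.hom_ext
    apply LinearMap.ext
    intro y
    obtain ⟨y, rfl⟩ := Submodule.Quotient.mk_surjective _ y
    have h2 : (Submodule.Quotient.mk y : R ⧸ a ^ n) = y • Submodule.Quotient.mk 1 := by
      rw [← Submodule.Quotient.mk_smul]; simp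
    rw [h2]
    refine (map_smul f.hom y _).trans ?_
    rw [h, smul_zero]; rfl
  rw [this, Ext.mk₀_zero]

lemma ev_exists (a : Ideal R) (M : ModuleCat.{u} R) (n : ℕ) (y : M) (h : ∀ r ∈ a ^ n, r • y = 0) :
    ∃ x, ev a M n x = y := by
  refine ⟨Ext.mk₀ (ModuleCat.ofHom (Submodule.liftQ _ (LinearMap.toSpanSingleton R M y) ?_)), ?_⟩
  · intro r hr
    exact h r hr
  · rw [ev_mk₀]
    change (1 : R) • y = y
    rw [one_smul]

lemma ev_compat (a : Ideal R) (M : ModuleCat.{u} R) {n m : ℕ} (h : n ≤ m) (x) :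
    ev a M m ((Ext.mk₀ (tq a h)).comp x (zero_add 0)) = ev a M n x := by
  obtain ⟨f, rfl⟩ := (Ext.mk₀_bijective _ _).2 x
  rw [Ext.mk₀_comp_mk₀, ev_mk₀, ev_mk₀]
  rfl

lemma ev_nat (a : Ideal R) {M N : ModuleCat.{u} R} (g : M ⟶ N) (n : ℕ) (x) :
    ev a N n (x.comp (Ext.mk₀ g) (add_zero 0)) = g.hom (ev a M n x) := by
  obtain ⟨f, rfl⟩ := (Ext.mk₀_bijective _ _).2 x
  rw [Ext.mk₀_comp_mk₀, ev_mk₀, ev_mk₀]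
  rfl

section base
variable (fs : List R) (a : Ideal R) (ha : a = Ideal.span {f | f ∈ fs}) 

lemma ev_range (ha : a = Ideal.span {f | f ∈ fs}) (M : ModuleCat.{u} R) (n : ℕ) (x) :
    ev a M n x ∈ LinearMap.range (Cx.hε M fs) := by
  rw [Cx.hε_range]
  intro f hf
  refine ⟨n, ev_kill a M n x _ (Ideal.pow_mem_pow ?_ _)⟩
  rw [ha]
  exact Ideal.subset_span hf

noncomputable def fam0 (ha : a = Ideal.span {f | f ∈ fs}) (M : ModuleCat.{u} R) (n : ℕ) :
    Abelian.Ext (Xq a n) M 0 →ₗ[R] ((Cx.K M fs).H 0) :=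
  (LinearEquiv.ofInjective (Cx.hε M fs) (Cx.hε_inj M fs)).symm.toLinearMap ∘ₗ
    (ev a M n).codRestrict _ (ev_range fs a ha M n)

lemma fam0_spec (ha : a = Ideal.span {f | f ∈ fs}) (M : ModuleCat.{u} R) (n : ℕ) (x) :
    Cx.hε M fs (fam0 fs a ha M n x) = ev a M n x := by
  have := (LinearEquiv.ofInjective (Cx.hε M fs) (Cx.hε_inj M fs)).apply_symm_apply
    ((ev a M n).codRestrict _ (ev_range fs a ha M n) x)
  exact congrArg Subtype.val this

noncomputable def Fam0 (ha : a = Ideal.span {f | f ∈ fs}) (M : ModuleCat.{u} R) : Fam fs a M 0 where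
  θ := fam0 fs a ha M
  compat h x := by
    apply Cx.hε_inj M fs
    rw [fam0_spec, fam0_spec, ev_compat]
  surj y := by
    have h1 : Cx.hε M fs y ∈ LinearMap.range (Cx.hε M fs) := ⟨y, rfl⟩
    rw [Cx.hε_range] at h1
    have h2 : a ≤ Ideal.radical (LinearMap.ker (LinearMap.toSpanSingleton R M (Cx.hε M fs y))) := by
      rw [ha, Ideal.span_le]
      intro f hf
      obtain ⟨k, hk⟩ := h1 f hf
      exact ⟨k, hk⟩
    have h3 : a.FG := by
      classical
      rw [ha]
      exact ⟨fs.toFinset, by simp⟩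
    obtain ⟨n, hn⟩ := Ideal.exists_pow_le_of_le_radical_of_fg h2 h3
    obtain ⟨x, hx⟩ := ev_exists a M n (Cx.hε M fs y) (fun r hr => hn hr)
    refine ⟨n, x, Cx.hε_inj M fs ?_⟩
    rw [fam0_spec, hx]
  ker n x h := by
    refine ⟨n, le_rfl, ?_⟩
    have : x = 0 := ev_inj a M n x (by rw [← fam0_spec fs a ha, h, map_zero])
    rw [this, Ext.comp_zero]

lemma fam0_nat (ha : a = Ideal.span {f | f ∈ fs}) {M N : ModuleCat.{u} R} (g : M ⟶ N) (n : ℕ) (x) :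
    (Fam0 fs a ha N).θ n (x.comp (Ext.mk₀ g) (add_zero 0)) =
      Cx.hmap (Cx.KHom g.hom fs) 0 ((Fam0 fs a ha M).θ n x) := by
  apply Cx.hε_inj N fs
  rw [Cx.hε_nat]
  refine (fam0_spec fs a ha N n _).trans ?_
  rw [ev_nat]
  exact congrArg _ (fam0_spec fs a ha M n x).symm
end base

lemma exists_lift {Z A B : Type u} [AddCommGroup Z] [Module R Z] [AddCommGroup A]
    [Module R A] [AddCommGroup B] [Module R B] (p : Z →ₗ[R] A) (q : Z →ₗ[R] B)
    (hp : Function.Surjective p) (h : ∀ z, p z = 0 → q z = 0) :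
    ∃ e : A →ₗ[R] B, ∀ z, e (p z) = q z := by
  have hk : LinearMap.ker p ≤ LinearMap.ker q := h
  refine ⟨(Submodule.liftQ _ q hk) ∘ₗ (p.quotKerEquivOfSurjective hp).symm.toLinearMap,
    fun z => ?_⟩
  have : (p.quotKerEquivOfSurjective hp).symm (p z) = Submodule.Quotient.mk z := by
    rw [LinearEquiv.symm_apply_eq]; rfl
  simp only [LinearMap.comp_apply, LinearEquiv.coe_coe, this]
  rfl

lemma fam_step [IsNoetherianRing R] (fs : List R) (a : Ideal R) (S : ShortComplex (ModuleCat.{u} R))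
    (hS : S.ShortExact)
    [Module.Injective R S.X₂] (i : ℕ) (FI : Fam fs a S.X₂ i) (FC : Fam fs a S.X₃ i)
    (hnat : ∀ n x, FC.θ n (x.comp (Ext.mk₀ S.g) (add_zero i)) =
      Cx.hmap (Cx.KHom S.g.hom fs) i (FI.θ n x)) : Nonempty (Fam fs a S.X₁ (i+1)) := by
  have hinj : Function.Injective S.f.hom := (ModuleCat.mono_iff_injective _).1 hS.mono_f
  have hsurj : Function.Surjective S.g.hom := (ModuleCat.epi_iff_surjective _).1 hS.epi_g
  have hex : Function.Exact S.f.hom S.g.hom := by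
    intro y
    constructor
    · intro h
      exact (ShortComplex.moduleCat_exact_iff S).1 hS.exact y h
    · rintro ⟨x, rfl⟩
      exact ConcreteCategory.congr_hom S.zero x
  obtain ⟨δ, hδ1, hδ2⟩ := Cx.les_del (Cx.KHom S.f.hom fs) (Cx.KHom S.g.hom fs)
    (Cx.KHom_inj _ hinj fs) (Cx.KHom_surj _ hsurj fs) (Cx.KHom_exact _ _ hex fs) i
  have hH : Subsingleton ((Cx.K S.X₂ fs).H (i+1)) :=
    Cx.H_sub _ _ (fun x hx => Cx.K_inj S.X₂ fs i x hx)
  have hδs : Function.Surjective δ := fun y => (hδ2 y).1 (Subsingleton.elim _ _)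
  have hI : CategoryTheory.Injective S.X₂ := Module.injective_object_of_injective_module R S.X₂
  let D : ∀ n, Abelian.Ext (Xq a n) S.X₃ i →ₗ[R] Abelian.Ext (Xq a n) S.X₁ (i+1) := fun n =>
    Ext.postcompOfLinear hS.extClass R (Xq a n) rfl
  have hDdef : ∀ n x, D n x = x.comp hS.extClass rfl := fun n x => rfl
  have hDs : ∀ n, Function.Surjective (D n) := fun n y =>
    Ext.covariant_sequence_exact₁ (Xq a n) hS y (Ext.eq_zero_of_injective _) rfl
  have hDk : ∀ n x, D n x = 0 → ∃ z : Abelian.Ext (Xq a n) S.X₂ i,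
      z.comp (Ext.mk₀ S.g) (add_zero i) = x := fun n x hx =>
    Ext.covariant_sequence_exact₃ (Xq a n) hS x rfl hx
  have hDz : ∀ n (z : Abelian.Ext (Xq a n) S.X₂ i), D n (z.comp (Ext.mk₀ S.g) (add_zero i)) = 0 := fun n z => by
    rw [hDdef]; simp
  have hDt : ∀ {n m} (h : n ≤ m) x, D m ((Ext.mk₀ (tq a h)).comp x (zero_add i)) =
      (Ext.mk₀ (tq a h)).comp (D n x) (zero_add (i+1)) := fun h x => by
    rw [hDdef, hDdef]
    apply Ext.comp_assoc
    omega
  have hth : ∀ n, ∃ e : Abelian.Ext (Xq a n) S.X₁ (i+1) →ₗ[R] ((Cx.K S.X₁ fs).H (i+1)),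
      ∀ z, e (D n z) = δ (FC.θ n z) := fun n =>
    exists_lift (D n) (δ ∘ₗ FC.θ n) (hDs n) (fun z hz => by
      obtain ⟨w, rfl⟩ := hDk n z hz
      rw [LinearMap.comp_apply, hnat]
      exact (hδ1 _).2 ⟨_, rfl⟩)
  choose e he using hth
  refine ⟨⟨e, ?_, ?_, ?_⟩⟩
  · intro n m h x
    obtain ⟨x, rfl⟩ := hDs n x
    rw [← hDt, he, he, FC.compat]
  · intro y
    obtain ⟨y, rfl⟩ := hδs y
    obtain ⟨n, x, rfl⟩ := FC.surj y
    exact ⟨n, D n x, he n x⟩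
  · intro n x hx
    obtain ⟨x, rfl⟩ := hDs n x
    rw [he] at hx
    obtain ⟨z, hz⟩ := (hδ1 _).1 hx
    obtain ⟨m, w, rfl⟩ := FI.surj z
    rw [← hnat] at hz
    have hk : FC.θ (max n m) ((Ext.mk₀ (tq a (le_max_left n m))).comp x (zero_add i) -
        ((Ext.mk₀ (tq a (le_max_right n m))).comp w (zero_add i)).comp (Ext.mk₀ S.g) (add_zero i))
          = 0 := by
      rw [map_sub, FC.compat, Ext.comp_assoc_of_third_deg_zero, FC.compat, hz, sub_self]
    obtain ⟨k, hk1, hk2⟩ := FC.ker _ _ hk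
    refine ⟨k, (le_max_left n m).trans hk1, ?_⟩
    rw [← hDt, ← tq_comp a (le_max_left n m) hk1, ← Ext.mk₀_comp_mk₀_assoc, hDt]
    have h5 : D (max n m) ((Ext.mk₀ (tq a (le_max_left n m))).comp x (zero_add i)) =
      D (max n m) ((Ext.mk₀ (tq a (le_max_left n m))).comp x (zero_add i) -
        ((Ext.mk₀ (tq a (le_max_right n m))).comp w (zero_add i)).comp (Ext.mk₀ S.g) (add_zero i)) := by
      rw [map_sub, hDz, sub_zero]
    rw [h5, ← hDt, hk2, map_zero]

lemma exists_fam [IsNoetherianRing R] (fs : List R) (a : Ideal R) (ha : a = Ideal.span {f | f ∈ fs})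
    (i : ℕ) : ∀ M : ModuleCat.{u} R, Nonempty (Fam fs a M i) := by
  induction i with
  | zero => exact fun M => ⟨Fam0 fs a ha M⟩
  | succ i ih =>
    intro M
    obtain ⟨I, f, hI, hf⟩ := exists_inj_embed R M
    let S : ShortComplex (ModuleCat.{u} R) := ShortComplex.mk (ModuleCat.ofHom f)
      (ModuleCat.ofHom (LinearMap.range f).mkQ) (by
        ext x
        exact (Submodule.Quotient.mk_eq_zero _).2 ⟨x, rfl⟩)
    have hS : S.ShortExact := by
      have : Mono S.f := (ModuleCat.mono_iff_injective _).2 hf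
      have : Epi S.g := (ModuleCat.epi_iff_surjective _).2 (Submodule.mkQ_surjective _)
      refine ⟨(ShortComplex.moduleCat_exact_iff S).2 fun y hy => ?_⟩
      exact (Submodule.Quotient.mk_eq_zero _).1 hy
    have hI2 : Module.Injective R S.X₂ := hI
    have hI3 : CategoryTheory.Injective S.X₂ := Module.injective_object_of_injective_module R S.X₂
    rcases i with _ | i
    · exact fam_step fs a S hS 0 (Fam0 fs a ha S.X₂) (Fam0 fs a ha S.X₃)
        (fun n x => fam0_nat fs a ha S.g n x)
    · obtain ⟨FI⟩ := ih S.X₂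
      obtain ⟨FC⟩ := ih S.X₃
      refine fam_step fs a S hS (i+1) FI FC (fun n x => ?_)
      rw [Ext.eq_zero_of_injective x, Ext.zero_comp, map_zero, map_zero, map_zero]

end ExtCmp

set_option linter.unusedSectionVars false

namespace ExtCmp
open Abelian Limits
variable {R : Type u} [CommRing R]

lemma exists_rep_colim (F : ℕᵒᵖᵒᵖ ⥤ ModuleCat.{u} R) (c : Cocone F) (hc : IsColimit c)
    (x : c.pt) : ∃ t, ∃ y : F.obj t, (c.ι.app t) y = x := by
  have : PreservesFilteredColimitsOfSize.{0, 0} (forget (ModuleCat.{u} R)) :=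
    preservesFilteredColimitsOfSize_shrink.{0, u, 0, u} _
  have : IsFiltered ℕᵒᵖᵒᵖ := inferInstance
  have : PreservesColimit F (forget (ModuleCat.{u} R)) := inferInstance
  exact Concrete.isColimit_exists_rep F hc x

lemma lc_equiv [IsNoetherianRing R] (fs : List R) (a : Ideal R)
    (ha : a = Ideal.span {f | f ∈ fs}) (i : ℕ) (M : ModuleCat.{u} R) :
    Nonempty ((localCohomology a i).obj M ≃ₗ[R] (Cx.K M fs).H i) := by
  obtain ⟨Fm⟩ := exists_fam fs a ha i M
  obtain ⟨e, he⟩ := exists_extEquiv i M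
  let D := localCohomology.diagram (localCohomology.idealPowersDiagram a) i
  have hD : HasColimit D := localCohomology.hasColimitDiagram.{u, 0} _ i
  let ev := (evaluation (ModuleCat.{u} R) (ModuleCat.{u} R)).obj M
  let c : Cocone (D ⋙ ev) := ev.mapCocone (colimit.cocone D)
  have hc : IsColimit c := isColimitOfPreserves ev (colimit.isColimit D)
  let s : Cocone (D ⋙ ev) :=
    { pt := ModuleCat.of R ((Cx.K M fs).H i)
      ι :=
        { app := fun t => ModuleCat.ofHom (Fm.θ t.unop.unop ∘ₗ (e (Xq a t.unop.unop)).toLinearMap)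
          naturality := by
            intro t t' w
            ext x
            have h : t.unop.unop ≤ t'.unop.unop := w.unop.unop.down.down
            exact (congrArg (Fm.θ _) (he (Xq a t.unop.unop) (Xq a t'.unop.unop) (tq a h) x)).trans
              (Fm.compat h _) } }
  let f : c.pt →ₗ[R] (Cx.K M fs).H i := (hc.desc s).hom
  have hf : ∀ t (x : (D ⋙ ev).obj t), f (c.ι.app t x) = Fm.θ t.unop.unop (e (Xq a t.unop.unop) x) := by
    intro t x
    have := hc.fac s t
    exact congrArg (fun g => g.hom x) this
  refine ⟨LinearEquiv.ofBijective f ⟨?_, ?_⟩⟩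
  · rw [injective_iff_map_eq_zero]
    intro x hx
    obtain ⟨t, y, rfl⟩ := exists_rep_colim _ c hc x
    rw [hf] at hx
    obtain ⟨m, h, hm⟩ := Fm.ker _ _ hx
    let w : t ⟶ Opposite.op (Opposite.op m) := Quiver.Hom.op (Quiver.Hom.op (homOfLE h))
    have h1 : (D ⋙ ev).map w y = 0 := by
      apply (e (Xq a m)).injective
      exact ((he (Xq a t.unop.unop) (Xq a m) (tq a h) y).trans hm).trans (map_zero (e (Xq a m))).symm
    have h2 := congrArg (fun g => g.hom y) (c.w w)
    change c.ι.app _ ((D ⋙ ev).map w y) = _ at h2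
    rw [h1, map_zero] at h2
    exact h2.symm
  · intro y
    obtain ⟨n, x, rfl⟩ := Fm.surj y
    refine ⟨c.ι.app (Opposite.op (Opposite.op n)) ((e (Xq a n)).symm x), ?_⟩
    exact (hf _ _).trans (congrArg (Fm.θ n) ((e (Xq a n)).apply_symm_apply x))

end ExtCmp

set_option linter.unusedSectionVars false

open IsLocalRing TensorProduct in
theorem core_compl {R : Type u} [CommRing R] [IsNoetherianRing R] [IsLocalRing R] (fs : List R)
    (hb : Ideal.span {f | f ∈ fs} ≤ maximalIdeal R) (d : ℕ)
    (hd : ringKrullDim R = (d : WithBot ℕ∞)) (A : Ideal R)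
    (hA : ∀ r ∈ A, ∀ x : (Cx.K R fs).H d, r • x = 0) :
    Subsingleton ((Cx.K A fs).H d) := by
  let S := AdicCompletion (maximalIdeal R) R
  let gs : List S := fs.map (algebraMap R S)
  let T : LCT S (Ideal.span {f | f ∈ gs}) := Cx.cech gs
  obtain ⟨E, hE1, hE2, hE3⟩ := exists_hull S
  have hff : Module.FaithfullyFlat R S := complFF R
  let r : S ⊗[R] R ≃ₗ[S] S := TensorProduct.AlgebraTensorModule.rid R S S
  let j : S ⊗[R] A →ₗ[S] S :=
    r.toLinearMap ∘ₗ TensorProduct.AlgebraTensorModule.lTensor S S (Submodule.subtype A)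
  have hj : Function.Injective j := by
    refine r.injective.comp ?_
    exact Module.Flat.lTensor_preserves_injective_linearMap (M := S) (Submodule.subtype A)
      A.injective_subtype
  have hgs : Ideal.span {f | f ∈ gs} ≤ maximalIdeal S := by
    rw [Ideal.span_le]
    intro g hg
    obtain ⟨f, hf, rfl⟩ := List.mem_map.1 hg
    rw [SetLike.mem_coe, mem_maximalIdeal, mem_nonunits_iff, isUnit_map_iff]
    exact (mem_maximalIdeal f).1 (hb (Ideal.subset_span hf))
  have hk : ∀ a ∈ A, ∀ x : T.obj d S, algebraMap R S a • x = 0 := by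
    intro a ha x
    obtain ⟨φ, hφ⟩ := Cx.bcK S R fs
    obtain ⟨y, rfl⟩ := (T.mapEquiv d r).surjective x
    rw [← map_smul]
    have h9 : ∀ z : (Cx.K (S ⊗[R] R) gs).H d, algebraMap R S a • z = 0 := by
      intro z
      apply (Cx.IsoCx.hmap_bij φ hφ d).1
      refine ((Cx.hmap φ d).map_smul _ z).trans ?_
      exact (Cx.bc_kill S _ d a (hA a ha) _).trans (map_zero (Cx.hmap φ d)).symm
    have : algebraMap R S a • y = 0 := h9 y
    rw [this, map_zero]
  have hz : ∀ (u : S ⊗[R] A) (x : T.obj d S), j u • x = 0 := by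
    intro u x
    induction u with
    | zero => rw [map_zero, zero_smul]
    | add u v hu hv => rw [map_add, add_smul, hu, hv, add_zero]
    | tmul s a =>
      have : j (s ⊗ₜ a) = s * algebraMap R S a := by
        simp [j, r, Algebra.smul_def, mul_comm]
      rw [this, mul_smul, hk _ a.2, smul_zero]
  have h0 : Subsingleton (T.obj d (S ⊗[R] A)) :=
    LCT.main_complete T E hE2 hgs hE3 d ((compl_dim R).trans hd.le) (S ⊗[R] A) j hj hz
  obtain ⟨φ, hφ⟩ := Cx.bcK S A fs
  apply Cx.bc_reflect S
  exact (Cx.IsoCx.hmap_bij φ hφ d).2.subsingleton (α := T.obj d (S ⊗[R] A))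

theorem stmt_11 {R : Type u} [CommRing R] [IsNoetherianRing R] [IsLocalRing R] (𝔞 : Ideal R)
    (d : ℕ) (hd : ringKrullDim R = (d : WithBot ℕ∞)) (htop : LCNonzero 𝔞 d R) :
    cohDim 𝔞 ↥(Module.annihilator R ((localCohomology 𝔞 d).obj (ModuleCat.of R R))) < (d : ℕ∞) ∧
      ∀ J : Ideal R, cohDim 𝔞 ↥J < (d : ℕ∞) →
        J ≤ Module.annihilator R ((localCohomology 𝔞 d).obj (ModuleCat.of R R)) := by
  obtain ⟨s, hs⟩ := (IsNoetherian.noetherian 𝔞 : 𝔞.FG)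
  let fs := s.toList
  have ha : 𝔞 = Ideal.span {f | f ∈ fs} := by
    rw [← hs]
    congr 1
    ext x
    simp [fs]
  let T : LCT R (Ideal.span {f | f ∈ fs}) := Cx.cech fs
  obtain ⟨eR⟩ := ExtCmp.lc_equiv fs 𝔞 ha d (ModuleCat.of R R)
  have hann := eR.annihilator_eq
  have hR : Nontrivial (T.obj d R) := eR.symm.toEquiv.nontrivial
  constructor
  · generalize hA' : Module.annihilator R ((localCohomology 𝔞 d).obj (ModuleCat.of R R)) = A
    have hA : ∀ r ∈ A, ∀ x : (Cx.K R fs).H d, r • x = 0 := by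
      intro r hr x
      rw [← hA', hann] at hr
      exact Module.mem_annihilator.1 hr x
    have hb : Ideal.span {f | f ∈ fs} ≤ IsLocalRing.maximalIdeal R := by
      apply IsLocalRing.le_maximalIdeal
      intro htop'
      obtain ⟨x, hx⟩ := exists_ne (0 : T.obj d R)
      obtain ⟨n, hn⟩ := T.tors d R x
      apply hx
      have h1 : (1 : R) ∈ Ideal.span {f | f ∈ fs} ^ n := by
        rw [htop', Ideal.top_pow]
        trivial
      simpa using hn 1 h1
    have hv : ∀ i : ℕ, LCNonzero 𝔞 i A → i < d := by
      intro i hi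
      by_contra hid
      obtain ⟨eA⟩ := ExtCmp.lc_equiv fs 𝔞 ha i (ModuleCat.of R A)
      have hn : Nontrivial (T.obj i A) := eA.symm.toEquiv.nontrivial
      have hsub : Subsingleton (T.obj i A) := by
        rcases (not_lt.1 hid).eq_or_lt with h | h
        · subst h
          exact core_compl fs hb d hd A hA
        · apply T.vanish
          intro p _
          refine lt_of_le_of_lt (ringKrullDim_quotient_le p.asIdeal) ?_
          rw [hd]
          exact_mod_cast h
      exact not_nontrivial_iff_subsingleton.2 hsub hn
    unfold cohDim
    rcases Nat.eq_zero_or_pos d with h0 | h0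
    · have : {n : WithBot ℕ∞ | ∃ i : ℕ, n = (i : ℕ∞) ∧ LCNonzero 𝔞 i A} = ∅ := by
        ext n
        simp only [Set.mem_ofPred_eq, Set.mem_empty_iff_false, iff_false]
        rintro ⟨i, _, hi⟩
        have := hv i hi
        omega
      rw [this, sSup_empty]
      exact WithBot.bot_lt_coe _
    · refine lt_of_le_of_lt (b := (((d - 1 : ℕ) : ℕ∞) : WithBot ℕ∞)) (sSup_le ?_) ?_
      · rintro n ⟨i, rfl, hi⟩
        have := hv i hi
        have h2 : i ≤ d - 1 := by omega
        exact_mod_cast h2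
      · have h2 : d - 1 < d := by omega
        exact_mod_cast h2
  · intro J hJ x hx
    rw [hann, Module.mem_annihilator]
    suffices hmain : ∀ y : T.obj d R, x • y = 0 from fun y => hmain y
    intro y
    have hJ0 : Subsingleton (T.obj d J) := by
      by_contra hcon
      rw [not_subsingleton_iff_nontrivial] at hcon
      obtain ⟨eJ⟩ := ExtCmp.lc_equiv fs 𝔞 ha d (ModuleCat.of R J)
      have hcon' : Nontrivial ((Cx.K (ModuleCat.of R J) fs).H d) := hcon
      have hn : LCNonzero 𝔞 d J := eJ.toEquiv.nontrivial
      have hle : ((d : ℕ∞) : WithBot ℕ∞) ≤ cohDim 𝔞 J := le_sSup ⟨d, rfl, hn⟩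
      exact absurd hle (not_le.2 hJ)
    let g : R →ₗ[R] J := LinearMap.toSpanSingleton R J ⟨x, hx⟩
    have hfac : mulS R x = J.subtype ∘ₗ g := by
      ext
      simp [g]
    have h1 := T.smul_apply d x (M := R) y
    rw [hfac, T.map_comp, LinearMap.comp_apply, Subsingleton.elim (T.map d g y) 0, map_zero] at h1
    exact h1.symm
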